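/- arXiv:math/0611321 — 2 statements merged into one kernel-verified Lean document; each statement's English description precedes it below -/
import Mathlib

section
/- Let $M_n$ be the $n \times n$ random matrix whose entries are i.i.d. random variables taking values $+1$ and $-1$ each with probability $1/2$. For every pair of constants $A > 0$ and $C > 0$ there is a constant $B > 0$ such that for all sufficiently large $n$ and every fixed (deterministic) $n \times n$ real matrix $M$ with $\|M\| \leq n^C$, one has $\mathbb{P}\big(M + M_n \text{ is singular, or } \|M + M_n\| \cdot \|(M + M_n)^{-1}\| \geq n^B\big) \leq n^{-A}$, where $\|\cdot\|$ denotes the operator norm with respect to the Euclidean norm on $\mathbb{R}^n$. -/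
/-- The spectral (operator) norm of a real `n × n` matrix: the operator norm of the
induced linear map on Euclidean space, `‖M‖ = sup_{‖v‖ = 1} ‖M v‖`. -/
noncomputable def specNorm {n : ℕ} (M : Matrix (Fin n) (Fin n) ℝ) : ℝ :=
  ‖LinearMap.toContinuousLinearMap (Matrix.toEuclideanLin M)‖

open Finset Classical in
/-- Uniform probability of an event on a finite type. -/
noncomputable def pr {Ω : Type*} [Fintype Ω] (p : Ω → Prop) : ℝ :=
  ((univ.filter p).card : ℝ) / Fintype.card Ω

section UniformProbability

open Finset Classical

variable {Ω Ω' : Type*} [Fintype Ω] [Fintype Ω']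

lemma pr_eq_card (p : Ω → Prop) [DecidablePred p] :
    pr p = ((univ.filter p).card : ℝ) / Fintype.card Ω := by
  unfold pr
  congr!

lemma pr_nonneg (p : Ω → Prop) : 0 ≤ pr p := by unfold pr; positivity

lemma pr_le_one (p : Ω → Prop) : pr p ≤ 1 := by
  unfold pr
  apply div_le_one_of_le₀ _ (by positivity)
  exact_mod_cast (card_filter_le _ _)

lemma pr_mono {p q : Ω → Prop} (h : ∀ ω, p ω → q ω) : pr p ≤ pr q := by
  unfold pr
  apply div_le_div_of_nonneg_right _ (by positivity)
  exact_mod_cast card_le_card (monotone_filter_right _ fun ω _ => h ω)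

lemma pr_eq_sum (p : Ω → Prop) :
    pr p = (∑ ω, if p ω then (1 : ℝ) else 0) / Fintype.card Ω := by
  unfold pr
  simp

lemma pr_comp_equiv (e : Ω' ≃ Ω) (p : Ω → Prop) : pr (fun x => p (e x)) = pr p := by
  rw [pr_eq_sum, pr_eq_sum, Fintype.card_congr e]
  congr 1
  exact e.sum_comp (fun x => if p x then (1 : ℝ) else 0)

lemma pr_or_le (p q : Ω → Prop) : pr (fun ω => p ω ∨ q ω) ≤ pr p + pr q := by
  rw [pr_eq_card, pr_eq_card, pr_eq_card, ← add_div]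
  gcongr
  rw [filter_or]
  exact_mod_cast card_union_le _ _

lemma pr_exists_le {κ : Type*} (s : Finset κ) (p : κ → Ω → Prop) :
    pr (fun ω => ∃ k ∈ s, p k ω) ≤ ∑ k ∈ s, pr (p k) := by
  simp only [pr_eq_card]
  rw [← sum_div]
  gcongr
  have : (univ.filter fun ω => ∃ k ∈ s, p k ω) ⊆ s.biUnion fun k => univ.filter (p k) := by
    intro ω
    simp
  exact_mod_cast (card_le_card this).trans (card_biUnion_le (t := fun k => univ.filter (p k)))

lemma pr_prod (p : Ω × Ω' → Prop) :
    pr p = (∑ a, pr fun b => p (a, b)) / Fintype.card Ω := by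
  simp only [pr_eq_sum]
  rw [Fintype.card_prod, Fintype.sum_prod_type, ← sum_div, div_div, Nat.cast_mul, mul_comm]

lemma pr_prod_le [Nonempty Ω] (p : Ω × Ω' → Prop) {c : ℝ} (h : ∀ a, pr (fun b => p (a, b)) ≤ c) :
    pr p ≤ c := by
  rw [pr_prod, div_le_iff₀ (by exact_mod_cast Fintype.card_pos)]
  calc _ ≤ ∑ a : Ω, c := sum_le_sum fun a _ => h a
    _ = _ := by simp [mul_comm]

lemma exists_lt_pr_of_lt_pr_prod [Nonempty Ω] (p : Ω × Ω' → Prop) {c : ℝ} (h : c < pr p) :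
    ∃ a, c < pr (fun b => p (a, b)) := by
  by_contra! hc
  exact absurd (pr_prod_le p hc) (not_le.2 h)

lemma pr_fst [Nonempty Ω'] (p : Ω → Prop) : pr (fun x : Ω × Ω' => p x.1) = pr p := by
  have hc : (Fintype.card Ω' : ℝ) ≠ 0 := by exact_mod_cast Fintype.card_ne_zero
  simp only [pr_eq_sum]
  rw [Fintype.card_prod, Fintype.sum_prod_type]
  have : ∀ x : Ω, ∑ _y : Ω', (if p x then (1 : ℝ) else 0) =
      Fintype.card Ω' * if p x then (1 : ℝ) else 0 := fun x => by
    rw [sum_const, card_univ, nsmul_eq_mul]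
  simp only [this]
  rw [← mul_sum, Nat.cast_mul, mul_comm, mul_div_mul_right _ _ hc]

lemma pr_not [Nonempty Ω] (p : Ω → Prop) : pr (fun ω => ¬ p ω) = 1 - pr p := by
  have hc : (Fintype.card Ω : ℝ) ≠ 0 := by exact_mod_cast Fintype.card_ne_zero
  unfold pr
  rw [eq_sub_iff_add_eq, ← add_div, div_eq_one_iff_eq hc, ← Nat.cast_add, add_comm,
    card_filter_add_card_filter_not, card_univ]

lemma pr_forall {κ : Type*} [Fintype κ] {β : Type*} [Fintype β] (p : κ → β → Prop) :
    pr (fun s : κ → β => ∀ k, p k (s k)) = ∏ k, pr (p k) := by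
  simp only [pr_eq_card]
  rw [prod_div_distrib]
  have : (univ.filter fun s : κ → β => ∀ k, p k (s k)) =
      Fintype.piFinset fun k => univ.filter (p k) := by
    ext s; simp
  rw [this, Fintype.card_piFinset]
  simp

/-- Resampling one coordinate of a product space. -/
lemma pr_update {κ : Type*} [Fintype κ] {β : Type*} [Fintype β] [Nonempty β] (k : κ)
    (p : (κ → β) → Prop) :
    pr p = pr (fun x : (κ → β) × β => p (Function.update x.1 k x.2)) := by
  have hinv : Function.Involutive
      (fun x : (κ → β) × β => (Function.update x.1 k x.2, x.1 k)) := by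
    rintro ⟨s, b⟩
    simp
  rw [← pr_fst (Ω' := β) p, ← pr_comp_equiv hinv.toPerm]
  rfl

lemma pr_update_le {κ : Type*} [Fintype κ] {β : Type*} [Fintype β] [Nonempty β] (k : κ)
    (p : (κ → β) → Prop) {c : ℝ} (h : ∀ s, pr (fun b => p (Function.update s k b)) ≤ c) :
    pr p ≤ c := by
  rw [pr_update k]
  exact pr_prod_le _ h

/-- Functions of disjoint sets of coordinates are independent. -/
lemma pr_indep {κ β : Type*} [Fintype κ] [Fintype β] [Nonempty β] {X Y : Type*} (J : Finset κ)
    (f : (κ → β) → X) (g : (κ → β) → Y)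
    (hf : ∀ s t, (∀ k ∈ J, s k = t k) → f s = f t)
    (hg : ∀ s t, (∀ k, k ∉ J → s k = t k) → g s = g t) (p : X → Y → Prop) :
    pr (fun s => p (f s) (g s)) = pr (fun x : (κ → β) × (κ → β) => p (f x.1) (g x.2)) := by
  have hinv : Function.Involutive
      (fun x : (κ → β) × (κ → β) => (J.piecewise x.1 x.2, J.piecewise x.2 x.1)) := by
    rintro ⟨s, t⟩
    ext k <;> by_cases hk : k ∈ J <;> simp [hk]
  rw [← pr_fst (Ω' := κ → β) (fun s => p (f s) (g s)), ← pr_comp_equiv hinv.toPerm]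
  congr 1
  funext x
  have h1 : f (J.piecewise x.1 x.2) = f x.1 := hf _ _ fun k hk => by simp [hk]
  have h2 : g (J.piecewise x.1 x.2) = g x.2 := hg _ _ fun k hk => by simp [hk]
  change p (f (J.piecewise x.1 x.2)) (g (J.piecewise x.1 x.2)) = _
  rw [h1, h2]

end UniformProbability

section Concentration

open Finset Classical

variable {α β γ : Type*} [Fintype α] [Fintype β] [Fintype γ]

lemma sum_pr_le_one {κ : Type*} (N : Finset κ) (p : κ → α → Prop)
    (h : ∀ ω, ∀ u ∈ N, ∀ v ∈ N, p u ω → p v ω → u = v) : ∑ u ∈ N, pr (p u) ≤ 1 := by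
  simp only [pr_eq_card]
  rw [← sum_div]
  apply div_le_one_of_le₀ _ (by positivity)
  have hd : (N : Set κ).PairwiseDisjoint fun u => univ.filter (p u) := by
    intro u hu v hv huv
    rw [Function.onFun, Finset.disjoint_left]
    intro ω h1 h2
    exact huv (h ω u hu v hv (by simpa using h1) (by simpa using h2))
  have := card_biUnion hd
  rw [← Nat.cast_sum, ← this]
  exact_mod_cast card_le_univ _

/-- A set of large probability contains many well-separated values of a variable with small
concentration. -/
lemma exists_separated_values (Z : β → ℝ) {r Q : ℝ} (hr : 0 ≤ r)
    (hQ : ∀ x, pr (fun b => |Z b - x| ≤ r) ≤ Q) (G : Finset β) :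
    ∃ N : Finset ℝ, (∀ u ∈ N, ∃ b ∈ G, Z b = u) ∧
      (∀ u ∈ N, ∀ v ∈ N, u ≠ v → 2 * r < |u - v|) ∧ (G.card : ℝ) / Fintype.card β ≤ Q * N.card := by
  induction hn : G.card using Nat.strong_induction_on generalizing G with
  | _ n ih =>
    rcases G.eq_empty_or_nonempty with rfl | hne
    · exact ⟨∅, by simp, by simp, by simp [← hn]⟩
    obtain ⟨g, hg, hmin⟩ := G.exists_min_image Z hne
    set G' := G.filter fun b => Z g + 2 * r < Z b with hG'
    have hlt : G'.card < n := by
      rw [← hn]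
      apply card_lt_card
      rw [ssubset_iff_of_subset (filter_subset _ _)]
      exact ⟨g, hg, by simp [hr]⟩
    obtain ⟨N, h1, h2, h3⟩ := ih _ hlt G' rfl
    have hN : ∀ u ∈ N, Z g + 2 * r < u := by
      intro u hu
      obtain ⟨b, hb, rfl⟩ := h1 u hu
      exact (mem_filter.1 hb).2
    have hnot : Z g ∉ N := fun h => by linarith [hN _ h]
    refine ⟨insert (Z g) N, ?_, ?_, ?_⟩
    · intro u hu
      rcases mem_insert.1 hu with rfl | hu
      · exact ⟨g, hg, rfl⟩
      · obtain ⟨b, hb, rfl⟩ := h1 u hu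
        exact ⟨b, (mem_filter.1 hb).1, rfl⟩
    · intro u hu v hv huv
      rcases mem_insert.1 hu with rfl | hu <;> rcases mem_insert.1 hv with rfl | hv
      · exact absurd rfl huv
      · rw [abs_sub_comm]
        exact lt_of_lt_of_le (by linarith [hN v hv]) (le_abs_self _)
      · exact lt_of_lt_of_le (by linarith [hN u hu]) (le_abs_self _)
      · exact h2 u hu v hv huv
    · rw [card_insert_of_notMem hnot, Nat.cast_succ, mul_add, mul_one]
      have hsub : G ⊆ G' ∪ univ.filter fun b => |Z b - (Z g + r)| ≤ r := by
        intro b hb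
        have := hmin b hb
        rw [mem_union, mem_filter, mem_filter]
        by_cases hb' : Z g + 2 * r < Z b
        · exact Or.inl ⟨hb, hb'⟩
        · refine Or.inr ⟨mem_univ _, abs_le.2 ⟨by linarith, by linarith⟩⟩
      have hc := (card_le_card hsub).trans (card_union_le _ _)
      have hc' : (n : ℝ) ≤ G'.card + (univ.filter fun b => |Z b - (Z g + r)| ≤ r).card := by
        rw [← hn]; exact_mod_cast hc
      calc (n : ℝ) / Fintype.card β
          ≤ (G'.card : ℝ) / Fintype.card β + pr (fun b => |Z b - (Z g + r)| ≤ r) := by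
            rw [pr_eq_card, ← add_div]
            gcongr
        _ ≤ _ := add_le_add h3 (hQ _)

lemma exists_quantile [Nonempty β] (Y : β → ℝ) :
    ∃ a, 1 / 10 ≤ pr (fun b => Y b ≤ a) ∧ 9 / 10 ≤ pr (fun b => a ≤ Y b) := by
  obtain ⟨m, -, hm⟩ := (univ : Finset β).exists_max_image Y univ_nonempty
  have h1 : pr (fun b => Y b ≤ Y m) = 1 := by
    rw [pr_eq_card, filter_true_of_mem (fun b hb => hm b hb), card_univ, div_self]
    exact_mod_cast Fintype.card_ne_zero
  have hne : (univ.filter fun c => 1 / 10 ≤ pr (fun b => Y b ≤ Y c)).Nonempty :=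
    ⟨m, by simp [h1]; norm_num⟩
  obtain ⟨c, hc, hmin⟩ := exists_min_image _ Y hne
  refine ⟨Y c, (mem_filter.1 hc).2, ?_⟩
  have h2 : pr (fun b => ¬ Y c ≤ Y b) ≤ 1 / 10 := by
    by_cases hE : (univ.filter fun b => Y b < Y c).Nonempty
    · obtain ⟨d, hd, hmax⟩ := exists_max_image _ Y hE
      have hdc := (mem_filter.1 hd).2
      have h3 : ¬ 1 / 10 ≤ pr (fun b => Y b ≤ Y d) := fun h =>
        absurd (hmin d (by simpa using h)) (not_le.2 hdc)
      refine le_trans (pr_mono fun b hb => ?_) (not_le.1 h3).le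
      exact hmax b (by simpa using hb)
    · have : pr (fun b => ¬ Y c ≤ Y b) = 0 := by
        rw [not_nonempty_iff_eq_empty] at hE
        rw [pr_eq_card]
        simp only [not_le, hE]
        simp
      rw [this]; norm_num
  rw [pr_not] at h2
  linarith

lemma exists_good_fiber [Nonempty β] (P : β → Prop) (hP : 1 / 10 ≤ pr P) (q : β × γ → Prop)
    (hq : pr q < 1 / 100) : ∃ b, P b ∧ pr (fun c => q (b, c)) ≤ 1 / 10 := by
  by_contra! h
  have hpos : (0 : ℝ) < Fintype.card β := by exact_mod_cast Fintype.card_pos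
  rw [pr_prod, div_lt_iff₀ hpos] at hq
  rw [pr_eq_sum, le_div_iff₀ hpos] at hP
  have : ∑ b, (1 / 10 : ℝ) * (if P b then 1 else 0) ≤ ∑ a, pr fun b => q (a, b) := by
    apply sum_le_sum
    intro b _
    split_ifs with hb
    · linarith [h b hb]
    · simpa using pr_nonneg _
  rw [← mul_sum] at this
  linarith

/-- Adding three independent variables decreases the concentration by a constant factor. -/
lemma pr_add_three_le [Nonempty α] [Nonempty β] [Nonempty γ] (X : α → ℝ) (Y : β → ℝ) (Z : γ → ℝ)
    {r Q : ℝ} (hr : 0 ≤ r) (hQ : Q ≤ 1 / 10)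
    (hX : ∀ x, pr (fun a => |X a - x| ≤ r) ≤ Q) (hY : ∀ x, pr (fun a => |Y a - x| ≤ r) ≤ Q)
    (hZ : ∀ x, pr (fun a => |Z a - x| ≤ r) ≤ Q) (x : ℝ) :
    pr (fun t : (β × γ) × α => |X t.2 + (Y t.1.1 + Z t.1.2) - x| ≤ r) ≤ 999 / 1000 * Q := by
  have hQ0 : 0 ≤ Q := (pr_nonneg _).trans (hX 0)
  set F : ℝ → ℝ := fun u => pr (fun a => |X a + u - x| ≤ r) with hF
  have hFQ : ∀ u, F u ≤ Q := fun u => by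
    have := hX (x - u)
    convert this using 4
    ring_nf
  by_contra! hcon
  obtain ⟨q, hq⟩ : ∃ q : β × γ → Prop, ∀ t, q t ↔ ¬ 9 / 10 * Q ≤ F (Y t.1 + Z t.2) :=
    ⟨_, fun _ => Iff.rfl⟩
  have hq100 : pr q < 1 / 100 := by
    have hpos : (0 : ℝ) < Fintype.card (β × γ) := by exact_mod_cast Fintype.card_pos
    rw [pr_prod, lt_div_iff₀ hpos] at hcon
    have h1 : ∀ t : β × γ, pr (fun a => |X a + (Y t.1 + Z t.2) - x| ≤ r) ≤
        Q - Q / 10 * (if q t then 1 else 0) := by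
      intro t
      by_cases ht : q t
      · rw [if_pos ht]
        have := not_le.1 ((hq t).1 ht)
        simp only [hF] at this
        linarith
      · rw [if_neg ht]
        linarith [hFQ (Y t.1 + Z t.2)]
    have h2 := sum_le_sum fun t (_ : t ∈ univ) => h1 t
    rw [sum_sub_distrib, ← mul_sum, sum_const, card_univ, nsmul_eq_mul] at h2
    rw [pr_eq_sum, div_lt_iff₀ hpos]
    have h3 := lt_of_lt_of_le hcon h2
    have hQpos : 0 < Q := by
      rcases hQ0.eq_or_lt with h | h
      · rw [← h] at h3; simp at h3
      · exact h
    by_contra! hh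
    nlinarith
  obtain ⟨a, ha1, ha2⟩ := exists_quantile Y
  obtain ⟨b', hb1', hb2'⟩ := exists_quantile (fun c => - Z c)
  obtain ⟨b, rfl⟩ : ∃ b, b' = -b := ⟨-b', by ring⟩
  have hb1 : 1 / 10 ≤ pr (fun c => b ≤ Z c) := by simpa using hb1'
  have hb2 : 9 / 10 ≤ pr (fun c => Z c ≤ b) := by simpa using hb2'
  obtain ⟨y0, hy0, hy0'⟩ := exists_good_fiber _ ha1 q hq100
  obtain ⟨z1, hz1, hz1'⟩ := exists_good_fiber (γ := β) _ hb1 (fun t => q t.swap) (by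
    rw [← pr_comp_equiv (Equiv.prodComm γ β)] at hq100
    exact hq100)
  set G1 : Finset γ := univ.filter fun c => Z c < b - 2 * r ∧ 9 / 10 * Q ≤ F (Y y0 + Z c)
  set G2 : Finset β := univ.filter fun c => a ≤ Y c ∧ 9 / 10 * Q ≤ F (Y c + Z z1)
  have hG1 : 7 / 10 ≤ (#G1 : ℝ) / Fintype.card γ := by
    rw [← pr_eq_card]
    have h1 : pr (fun c => Z c ≤ b) ≤ pr (fun c => (Z c < b - 2 * r ∧
        9 / 10 * Q ≤ F (Y y0 + Z c)) ∨ (|Z c - (b - r)| ≤ r ∨ q (y0, c))) := by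
      apply pr_mono
      intro c hc
      by_cases h1 : Z c < b - 2 * r
      · by_cases h2 : 9 / 10 * Q ≤ F (Y y0 + Z c)
        · exact Or.inl ⟨h1, h2⟩
        · exact Or.inr (Or.inr ((hq _).2 h2))
      · exact Or.inr (Or.inl (abs_le.2 ⟨by linarith, by linarith⟩))
    have h2 := pr_or_le (fun c => (Z c < b - 2 * r ∧
        9 / 10 * Q ≤ F (Y y0 + Z c))) (fun c => (|Z c - (b - r)| ≤ r ∨ q (y0, c)))
    have h3 := pr_or_le (fun c => |Z c - (b - r)| ≤ r) (fun c => q (y0, c))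
    have h4 := hZ (b - r)
    linarith
  have hG2 : 8 / 10 ≤ (#G2 : ℝ) / Fintype.card β := by
    rw [← pr_eq_card]
    have h1 : pr (fun c => a ≤ Y c) ≤ pr (fun c => (a ≤ Y c ∧
        9 / 10 * Q ≤ F (Y c + Z z1)) ∨ q (c, z1)) := by
      apply pr_mono
      intro c hc
      by_cases h2 : 9 / 10 * Q ≤ F (Y c + Z z1)
      · exact Or.inl ⟨hc, h2⟩
      · exact Or.inr ((hq _).2 h2)
    have h2 := pr_or_le (fun c => (a ≤ Y c ∧ 9 / 10 * Q ≤ F (Y c + Z z1))) (fun c => q (c, z1))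
    have h3 : pr (fun c => q (c, z1)) ≤ 1 / 10 := hz1'
    linarith
  obtain ⟨N1, h11, h12, h13⟩ := exists_separated_values (fun c => Y y0 + Z c) (Q := Q) hr
    (fun u => by
      convert hZ (u - Y y0) using 4
      ring_nf) G1
  obtain ⟨N2, h21, h22, h23⟩ := exists_separated_values (fun c => Y c + Z z1) (Q := Q) hr
    (fun u => by
      convert hY (u - Z z1) using 4
      ring_nf) G2
  have hN1 : ∀ u ∈ N1, u < a + b - 2 * r ∧ 9 / 10 * Q ≤ F u := by
    intro u hu
    obtain ⟨c, hc, rfl⟩ := h11 u hu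
    have := (mem_filter.1 hc).2
    exact ⟨by linarith [this.1], this.2⟩
  have hN2 : ∀ u ∈ N2, a + b ≤ u ∧ 9 / 10 * Q ≤ F u := by
    intro u hu
    obtain ⟨c, hc, rfl⟩ := h21 u hu
    have := (mem_filter.1 hc).2
    exact ⟨by linarith [this.1], this.2⟩
  have hdisj : Disjoint N1 N2 := by
    rw [Finset.disjoint_left]
    intro u h1 h2
    linarith [(hN1 u h1).1, (hN2 u h2).1]
  have hsep : ∀ u ∈ N1 ∪ N2, ∀ v ∈ N1 ∪ N2, u ≠ v → 2 * r < |u - v| := by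
    intro u hu v hv huv
    rcases mem_union.1 hu with hu | hu <;> rcases mem_union.1 hv with hv | hv
    · exact h12 u hu v hv huv
    · rw [abs_sub_comm]
      exact lt_of_lt_of_le (by linarith [(hN1 u hu).1, (hN2 v hv).1]) (le_abs_self _)
    · exact lt_of_lt_of_le (by linarith [(hN2 u hu).1, (hN1 v hv).1]) (le_abs_self _)
    · exact h22 u hu v hv huv
  have hsum : ∑ u ∈ N1 ∪ N2, F u ≤ 1 := by
    apply sum_pr_le_one
    intro ω u hu v hv h1 h2
    by_contra huv
    have h3 := hsep u hu v hv huv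
    have h4 : |u - v| ≤ |X ω + u - x| + |X ω + v - x| := by
      have := abs_sub (X ω + u - x) (X ω + v - x)
      rwa [show X ω + u - x - (X ω + v - x) = u - v by ring] at this
    linarith
  have hlow : ((N1 ∪ N2).card : ℝ) * (9 / 10 * Q) ≤ ∑ u ∈ N1 ∪ N2, F u := by
    rw [← nsmul_eq_mul]
    apply card_nsmul_le_sum
    intro u hu
    rcases mem_union.1 hu with hu | hu
    · exact (hN1 u hu).2
    · exact (hN2 u hu).2
  rw [card_union_of_disjoint hdisj, Nat.cast_add] at hlow
  linarith

end Concentration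

/-- The sign `±1` encoded by a Boolean. -/
def sgn (b : Bool) : ℝ := if b = true then 1 else -1

lemma abs_sgn (b : Bool) : |sgn b| = 1 := by cases b <;> simp [sgn]

section SignedSums

open Finset Classical

variable {ι : Type*}

/-- The signed sum of the weights `w i`, `i ∈ J`. -/
def signedSum (J : Finset ι) (w : ι → ℝ) (ε : ι → Bool) : ℝ := ∑ i ∈ J, sgn (ε i) * w i

lemma signedSum_congr {J : Finset ι} {w w' : ι → ℝ} {ε ε' : ι → Bool}
    (hw : ∀ i ∈ J, w i = w' i) (h : ∀ i ∈ J, ε i = ε' i) :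
    signedSum J w ε = signedSum J w' ε' :=
  sum_congr rfl fun i hi => by rw [h i hi, hw i hi]

lemma signedSum_union {J K : Finset ι} (h : Disjoint J K) (w : ι → ℝ) (ε : ι → Bool) :
    signedSum (J ∪ K) w ε = signedSum J w ε + signedSum K w ε := sum_union h

lemma signedSum_sub (J : Finset ι) (w w' : ι → ℝ) (ε : ι → Bool) :
    signedSum J (w - w') ε = signedSum J w ε - signedSum J w' ε := by
  simp [signedSum, mul_sub]

lemma signedSum_smul (J : Finset ι) (a : ℝ) (w : ι → ℝ) (ε : ι → Bool) :
    signedSum J (a • w) ε = a * signedSum J w ε := by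
  simp only [signedSum, mul_sum, Pi.smul_apply, smul_eq_mul]
  exact sum_congr rfl fun i _ => by ring

lemma abs_signedSum_le {J : Finset ι} {w : ι → ℝ} {c : ℝ} (h : ∀ i ∈ J, |w i| ≤ c)
    (ε : ι → Bool) : |signedSum J w ε| ≤ J.card * c := by
  refine (abs_sum_le_sum_abs _ _).trans ?_
  rw [← nsmul_eq_mul]
  apply sum_le_card_nsmul
  intro i hi
  rw [abs_mul, abs_sgn, one_mul]
  exact h i hi

variable [Fintype ι]

/-- The signed sum of `w` over `J` hits some interval of radius `r` with probability
more than `p`. -/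
def Rich (J : Finset ι) (w : ι → ℝ) (r p : ℝ) : Prop :=
  ∃ x, p < pr (fun ε => |signedSum J w ε - x| ≤ r)

lemma not_rich_iff {J : Finset ι} {w : ι → ℝ} {r p : ℝ} :
    ¬ Rich J w r p ↔ ∀ x, pr (fun ε => |signedSum J w ε - x| ≤ r) ≤ p := by
  simp [Rich]

lemma Rich.lt_one {J : Finset ι} {w : ι → ℝ} {r p : ℝ} (h : Rich J w r p) : p < 1 :=
  h.elim fun _ hx => hx.trans_le (pr_le_one _)

lemma Rich.smul {J : Finset ι} {w : ι → ℝ} {r p : ℝ} (h : Rich J w r p) {a : ℝ} (ha : 0 < a) :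
    Rich J (a • w) (a * r) p := by
  obtain ⟨x, hx⟩ := h
  refine ⟨a * x, hx.trans_le (pr_mono fun ε hε => ?_)⟩
  rw [signedSum_smul, ← mul_sub, abs_mul, abs_of_pos ha]
  gcongr

lemma rich_subset {J K : Finset ι} (hKJ : K ⊆ J) {w : ι → ℝ} {r p : ℝ} (h : Rich J w r p) :
    Rich K w r p := by
  obtain ⟨x, hx⟩ := h
  have hS : ∀ ε, signedSum J w ε = signedSum (J \ K) w ε + signedSum K w ε := fun ε => by
    rw [← signedSum_union sdiff_disjoint, sdiff_union_of_subset hKJ]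
  simp only [hS] at hx
  rw [pr_indep (J \ K) (signedSum (J \ K) w) (signedSum K w)
    (fun s t hst => signedSum_congr (fun _ _ => rfl) hst)
    (fun s t hst => signedSum_congr (fun _ _ => rfl)
      fun k hk => hst k fun hk' => (mem_sdiff.1 hk').2 hk) (fun a b => |a + b - x| ≤ r)] at hx
  obtain ⟨a, ha⟩ := exists_lt_pr_of_lt_pr_prod _ hx
  refine ⟨x - signedSum (J \ K) w a, ha.trans_le (pr_mono fun ε hε => ?_)⟩
  convert hε using 2
  ring

/-- If the signed sums over three disjoint sets of indices have concentration at most `Q`, the sum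
over their union has smaller concentration. -/
lemma pr_signedSum_union_three_le {J K M : Finset ι} (h1 : Disjoint J K) (h2 : Disjoint (J ∪ K) M)
    (w : ι → ℝ) {r Q : ℝ} (hr : 0 ≤ r) (hQ : Q ≤ 1 / 10)
    (hJ : ∀ x, pr (fun ε => |signedSum J w ε - x| ≤ r) ≤ Q)
    (hK : ∀ x, pr (fun ε => |signedSum K w ε - x| ≤ r) ≤ Q)
    (hM : ∀ x, pr (fun ε => |signedSum M w ε - x| ≤ r) ≤ Q) (x : ℝ) :
    pr (fun ε => |signedSum (J ∪ K ∪ M) w ε - x| ≤ r) ≤ 999 / 1000 * Q := by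
  refine le_trans (le_of_eq ?_)
    (pr_add_three_le (signedSum M w) (signedSum J w) (signedSum K w) hr hQ hM hJ hK x)
  simp only [signedSum_union h1, signedSum_union h2]
  have hc : ∀ A : Finset ι, ∀ s t : ι → Bool, (∀ k ∈ A, s k = t k) →
      signedSum A w s = signedSum A w t :=
    fun A s t hst => signedSum_congr (fun _ _ => rfl) hst
  rw [pr_indep (J ∪ K) (fun ε => (signedSum J w ε, signedSum K w ε)) (signedSum M w)
    (fun s t hst => Prod.ext (hc _ _ _ fun k hk => hst k (mem_union_left _ hk))
      (hc _ _ _ fun k hk => hst k (mem_union_right _ hk)))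
    (fun s t hst => hc _ _ _ fun k hk => hst k fun hk' =>
      Finset.disjoint_left.1 h2 hk' hk) (fun a b => |a.1 + a.2 + b - x| ≤ r)]
  rw [← pr_comp_equiv (Equiv.prodComm _ _), ← pr_comp_equiv (Equiv.prodComm _ _)
    (fun t : ((ι → Bool) × (ι → Bool)) × (ι → Bool) => _), pr_prod, pr_prod]
  congr 1
  refine sum_congr rfl fun ε _ => ?_
  have := pr_indep J (signedSum J w) (signedSum K w) (hc _)
    (fun s t hst => hc _ _ _ fun k hk => hst k fun hk' =>
      Finset.disjoint_left.1 h1 hk' hk) (fun a b => |a + b + signedSum M w ε - x| ≤ r)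
  refine this.trans ?_
  congr 1
  funext t
  change (|signedSum J w t.1 + signedSum K w t.2 + signedSum M w ε - x| ≤ r) =
    (|signedSum M w ε + (signedSum J w t.1 + signedSum K w t.2) - x| ≤ r)
  rw [add_comm (signedSum M w ε)]

lemma pr_restrict (J : Finset ι) (p : (J → Bool) → Prop) :
    pr (fun ε : ι → Bool => p fun i => ε i) = pr p := by
  rw [← pr_fst (Ω' := ({i // ¬ i ∈ J} → Bool)) p,
    ← pr_comp_equiv (Equiv.piEquivPiSubtypeProd (fun i => i ∈ J) fun _ => Bool)]
  rfl

lemma pr_abs_sum_sub_le_choose (w : ι → ℝ) (hw : ∀ i, 1 < |w i|) (x : ℝ) :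
    pr (fun ε : ι → Bool => |∑ i, sgn (ε i) * w i - x| ≤ 1) ≤
      ((Fintype.card ι).choose (Fintype.card ι / 2) : ℝ) / 2 ^ Fintype.card ι := by
  rw [pr_eq_card, Fintype.card_fun, Fintype.card_bool, Nat.cast_pow, Nat.cast_two]
  gcongr
  set S := univ.filter fun ε : ι → Bool => |∑ i, sgn (ε i) * w i - x| ≤ 1 with hS
  set φ : (ι → Bool) → Finset ι := fun ε => univ.filter fun i => (ε i = true ↔ 0 < w i) with hφ
  have hinj : Function.Injective φ := by
    intro ε ε' h
    funext i
    have h1 : (i ∈ φ ε) ↔ (i ∈ φ ε') := by rw [h]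
    simp only [hφ, mem_filter, mem_univ, true_and] at h1
    rw [Bool.eq_iff_iff]
    tauto
  rw [← card_image_of_injective S hinj]
  apply IsAntichain.sperner
  intro A hA B hB hAB hsub
  obtain ⟨ε, hε, rfl⟩ := mem_image.1 (mem_coe.1 hA)
  obtain ⟨ε', hε', rfl⟩ := mem_image.1 (mem_coe.1 hB)
  have hsub' : φ ε ⊆ φ ε' := hsub
  obtain ⟨k, hk', hk⟩ : ∃ k ∈ φ ε', k ∉ φ ε := by
    by_contra! h
    exact hAB (Subset.antisymm hsub' h)
  have hterm : ∀ i, 0 ≤ sgn (ε' i) * w i - sgn (ε i) * w i := by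
    intro i
    have h1 : i ∈ φ ε → i ∈ φ ε' := fun h => hsub' h
    simp only [hφ, mem_filter, mem_univ, true_and] at h1
    rcases lt_or_ge 0 (w i) with h | h
    · cases h2 : ε i <;> cases h3 : ε' i <;> (simp [sgn, h, h2, h3] at h1 ⊢; try linarith)
    · have h' := not_lt.2 h
      cases h2 : ε i <;> cases h3 : ε' i <;> (simp [sgn, h', h2, h3] at h1 ⊢; try linarith)
  have hkterm : 2 < sgn (ε' k) * w k - sgn (ε k) * w k := by
    simp only [hφ, mem_filter, mem_univ, true_and] at hk hk'
    have h1 := hw k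
    rcases lt_or_ge 0 (w k) with h | h
    · rw [abs_of_pos h] at h1
      cases h2 : ε k <;> cases h3 : ε' k <;> (simp [sgn, h, h2, h3] at hk hk' ⊢; try linarith)
    · have h' := not_lt.2 h
      rw [abs_of_nonpos h] at h1
      cases h2 : ε k <;> cases h3 : ε' k <;> (simp [sgn, h', h2, h3] at hk hk' ⊢; try linarith)
  have hsum : 2 < ∑ i, (sgn (ε' i) * w i - sgn (ε i) * w i) :=
    hkterm.trans_le (single_le_sum (f := fun i => sgn (ε' i) * w i - sgn (ε i) * w i)
      (fun i _ => hterm i) (mem_univ k))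
  rw [sum_sub_distrib] at hsum
  have h1 := abs_le.1 (mem_filter.1 hε).2
  have h2 := abs_le.1 (mem_filter.1 hε').2
  linarith

/-- Signed sums of at least one hundred weights larger than one are not concentrated. -/
lemma pr_signedSum_le_tenth {J : Finset ι} (hJ : 100 ≤ J.card) {w : ι → ℝ}
    (hw : ∀ i ∈ J, 1 < |w i|) (x : ℝ) :
    pr (fun ε => |signedSum J w ε - x| ≤ 1) ≤ 1 / 10 := by
  obtain ⟨K, hKJ, hK⟩ := exists_subset_card_eq hJ
  suffices ¬ Rich J w 1 (1 / 10) from not_rich_iff.1 this x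
  refine fun h => absurd (rich_subset hKJ h) (not_rich_iff.2 fun y => ?_)
  have h1 := pr_abs_sum_sub_le_choose (fun i : K => w i) (fun i => hw i (hKJ i.2)) y
  have h0 := pr_restrict K (fun ε : K → Bool => |∑ i, sgn (ε i) * w i - y| ≤ 1)
  rw [Fintype.card_coe, hK] at h1
  replace h1 := h0.le.trans (le_of_eq_of_le (by congr!) h1)
  have h2 : ∀ ε : ι → Bool, signedSum K w ε = ∑ i : K, sgn (ε i) * w i := fun ε =>
    (sum_coe_sort K fun i => sgn (ε i) * w i).symm
  simp only [h2]
  refine h1.trans ?_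
  norm_num [Nat.choose_eq_descFactorial_div_factorial, Nat.descFactorial, Nat.factorial]

/-- Every large set of indices contains, among a bounded number of candidates, a block on which
the concentration is larger by a prescribed factor. -/
lemma exists_block_family {s : ℕ} (hs : 100 ≤ s) (j : ℕ) (J : Finset ι) (hJ : s * 3 ^ j ≤ J.card) :
    ∃ F : Finset (Finset ι), F.card ≤ 3 ^ j ∧ (∀ b ∈ F, b ⊆ J ∧ s ≤ b.card) ∧
      ∀ w : ι → ℝ, (∀ i ∈ J, 1 < |w i|) → ∀ p, Rich J w 1 p →
        ∃ b ∈ F, Rich b w 1 (p * (1000 / 999) ^ j) := by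
  induction j generalizing J with
  | zero => exact ⟨{J}, by simp, by simpa using hJ, fun w _ p h => ⟨J, by simp, by simpa using h⟩⟩
  | succ j ih =>
    rw [pow_succ] at hJ
    have hle : s * 3 ^ j ≤ J.card := by nlinarith
    obtain ⟨J1, hJ1, hc1⟩ := exists_subset_card_eq hle
    have hd1 : (J \ J1).card = J.card - s * 3 ^ j := by rw [card_sdiff_of_subset hJ1, hc1]
    obtain ⟨J2, hJ2, hc2⟩ := exists_subset_card_eq (s := J \ J1) (n := s * 3 ^ j) (by
      rw [hd1]; apply Nat.le_sub_of_add_le; nlinarith)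
    set J3 := (J \ J1) \ J2 with hJ3
    have hc3 : s * 3 ^ j ≤ J3.card := by
      rw [card_sdiff_of_subset hJ2, hc2, hd1]
      apply Nat.le_sub_of_add_le
      apply Nat.le_sub_of_add_le
      nlinarith
    have h12 : Disjoint J1 J2 := disjoint_of_subset_right hJ2 disjoint_sdiff
    have hun : J1 ∪ J2 ∪ J3 = J := by
      rw [union_assoc, union_sdiff_of_subset hJ2, union_sdiff_of_subset hJ1]
    have h123 : Disjoint (J1 ∪ J2) J3 := by
      rw [disjoint_union_left]
      exact ⟨disjoint_of_subset_right sdiff_subset disjoint_sdiff, disjoint_sdiff⟩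
    have hs2 : J2 ⊆ J := hJ2.trans sdiff_subset
    have hs3 : J3 ⊆ J := sdiff_subset.trans sdiff_subset
    obtain ⟨F1, hF1, hb1, hw1⟩ := ih J1 hc1.ge
    obtain ⟨F2, hF2, hb2, hw2⟩ := ih J2 hc2.ge
    obtain ⟨F3, hF3, hb3, hw3⟩ := ih J3 hc3
    refine ⟨F1 ∪ F2 ∪ F3, ?_, ?_, ?_⟩
    · have := card_union_le (F1 ∪ F2) F3
      have := card_union_le F1 F2
      rw [pow_succ]
      lia
    · intro b hb
      rcases mem_union.1 hb with hb | hb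
      · rcases mem_union.1 hb with hb | hb
        · exact ⟨(hb1 b hb).1.trans hJ1, (hb1 b hb).2⟩
        · exact ⟨(hb2 b hb).1.trans hs2, (hb2 b hb).2⟩
      · exact ⟨(hb3 b hb).1.trans hs3, (hb3 b hb).2⟩
    · intro w hw p hp
      have hbig : ∀ K ⊆ J, s * 3 ^ j ≤ K.card → ∀ x,
          pr (fun ε => |signedSum K w ε - x| ≤ 1) ≤ 1 / 10 := fun K hK hcK x =>
        pr_signedSum_le_tenth (hs.trans ((Nat.le_mul_of_pos_right s (by positivity)).trans hcK))
          (fun i hi => hw i (hK hi)) x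
      have key : Rich J1 w 1 (p * (1000 / 999)) ∨ Rich J2 w 1 (p * (1000 / 999)) ∨
          Rich J3 w 1 (p * (1000 / 999)) := by
        by_contra! hcon
        simp only [not_rich_iff] at hcon
        obtain ⟨x, hx⟩ := hp
        rw [← hun] at hx
        have := pr_signedSum_union_three_le h12 h123 w (Q := min (p * (1000 / 999)) (1 / 10))
          zero_le_one (min_le_right _ _)
          (fun x => le_min (hcon.1 x) (hbig J1 hJ1 hc1.ge x))
          (fun x => le_min (hcon.2.1 x) (hbig J2 hs2 hc2.ge x))
          (fun x => le_min (hcon.2.2 x) (hbig J3 hs3 hc3 x)) x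
        linarith [min_le_left (p * (1000 / 999)) (1 / 10 : ℝ)]
      have hpow : p * (1000 / 999) * (1000 / 999) ^ j = p * (1000 / 999) ^ (j + 1) := by
        rw [pow_succ]; ring
      rcases key with h | h | h
      · obtain ⟨b, hb, hr⟩ := hw1 w (fun i hi => hw i (hJ1 hi)) _ h
        exact ⟨b, by simp [hb], hpow ▸ hr⟩
      · obtain ⟨b, hb, hr⟩ := hw2 w (fun i hi => hw i (hs2 hi)) _ h
        exact ⟨b, by simp [hb], hpow ▸ hr⟩
      · obtain ⟨b, hb, hr⟩ := hw3 w (fun i hi => hw i (hs3 hi)) _ h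
        exact ⟨b, by simp [hb], hpow ▸ hr⟩

end SignedSums

section Spanners

open Finset Module

variable {ι : Type*} [Fintype ι]

/-- Every subspace of `ℝ^ι` has a basis, dual to some of the coordinates, all of whose entries are
at most one in absolute value. -/
lemma exists_coordinate_spanner (U : Submodule ℝ (ι → ℝ)) :
    ∃ (f : Fin (finrank ℝ U) → ι) (z : Fin (finrank ℝ U) → ι → ℝ),
      (∀ j, z j ∈ U) ∧ (∀ j i, |z j i| ≤ 1) ∧ (∀ j k, z j (f k) = if k = j then 1 else 0) ∧
      ∀ u ∈ U, u = ∑ j, u (f j) • z j := by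
  classical
  set d := finrank ℝ U with hd
  set B : Basis (Fin d) ℝ U := finBasis ℝ U with hB
  set G : Matrix ι (Fin d) ℝ := Matrix.of fun i k => (B k : ι → ℝ) i with hG
  have hrank : G.rank = d := by
    have h1 : LinearIndependent ℝ G.transpose.row := by
      have := B.linearIndependent.map' U.subtype (Submodule.ker_subtype U)
      exact this
    rw [← Matrix.rank_transpose, h1.rank_matrix, Fintype.card_fin]
  obtain ⟨f₀, hf₀⟩ : ∃ f₀ : Fin d → ι, (G.submatrix f₀ id).det ≠ 0 := by
    obtain ⟨κ, a, ha, hspan, hli⟩ := exists_linearIndependent' ℝ G.row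
    have : Finite κ := Finite.of_injective a ha
    have := Fintype.ofFinite κ
    have hκ : Fintype.card κ = d := by
      rw [← finrank_span_eq_card hli, hspan, ← Matrix.rank_eq_finrank_span_row, hrank]
    set e : Fin d ≃ κ := (Fintype.equivFinOfCardEq hκ).symm
    refine ⟨a ∘ e, ?_⟩
    rw [← isUnit_iff_ne_zero, ← Matrix.isUnit_iff_isUnit_det,
      ← Matrix.linearIndependent_rows_iff_isUnit]
    exact hli.comp e e.injective
  obtain ⟨f, -, hf⟩ := (univ : Finset (Fin d → ι)).exists_max_image
    (fun f => |(G.submatrix f id).det|) ⟨f₀, mem_univ _⟩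
  set A := G.submatrix f id with hA
  have hdet : A.det ≠ 0 := abs_pos.1 ((abs_pos.2 hf₀).trans_le (hf f₀ (mem_univ _)))
  have hunit : IsUnit A.det := isUnit_iff_ne_zero.2 hdet
  have hz : ∀ j i, (∑ k, A⁻¹ k j • (B k : ι → ℝ)) i = (G * A⁻¹) i j := fun j i => by
    simp [Matrix.mul_apply, hG, mul_comm]
  have hGA : ∀ i j, (G * A⁻¹) i j = (G.submatrix (Function.update f j i) id).det / A.det := by
    intro i j
    have h1 : G.submatrix (Function.update f j i) id = A.updateRow j (G i) := by
      ext r c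
      by_cases hr : r = j
      · subst hr; simp
      · simp [hr, hA]
    rw [h1, ← Matrix.cramer_transpose_apply, Matrix.cramer_eq_adjugate_mulVec,
      Matrix.inv_def, Ring.inverse_eq_inv', Matrix.mul_smul, Matrix.smul_apply, smul_eq_mul,
      div_eq_inv_mul, ← Matrix.adjugate_transpose, Matrix.mulVec_transpose]
    rfl
  have hAA : ∀ j k, (G * A⁻¹) (f k) j = if k = j then 1 else 0 := fun j k => by
    have : (A * A⁻¹) k j = (1 : Matrix _ _ ℝ) k j := by rw [Matrix.mul_nonsing_inv A hunit]
    rwa [Matrix.one_apply] at this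
  refine ⟨f, fun j i => (G * A⁻¹) i j, fun j => ?_, fun j i => ?_, fun j k => hAA j k,
    fun u hu => ?_⟩
  · have : (fun i => (G * A⁻¹) i j) = ∑ k, A⁻¹ k j • (B k : ι → ℝ) := by
      ext i
      rw [hz]
    change (fun i => (G * A⁻¹) i j) ∈ U
    rw [this]
    exact Submodule.sum_mem _ fun k _ => Submodule.smul_mem _ _ (B k).2
  · change |(G * A⁻¹) i j| ≤ 1
    rw [hGA, abs_div]
    exact div_le_one_of_le₀ (hf _ (mem_univ _)) (abs_nonneg _)
  · obtain ⟨c, hc⟩ : ∃ c : Fin d → ℝ, u = G.mulVec c := by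
      refine ⟨B.repr ⟨u, hu⟩, ?_⟩
      have := congrArg (Subtype.val) (B.sum_repr ⟨u, hu⟩)
      ext i
      refine (congrFun this i).symm.trans ?_
      rw [AddSubmonoidClass.coe_finsetSum]
      simp [Matrix.mulVec, dotProduct, hG, mul_comm]
    have hu2 : A.mulVec c = fun j => u (f j) := by
      rw [hc]; rfl
    have hu3 : u = (G * A⁻¹).mulVec (A.mulVec c) := by
      rw [Matrix.mulVec_mulVec, Matrix.mul_assoc, Matrix.nonsing_inv_mul A hunit, Matrix.mul_one,
        hc]
    rw [hu2] at hu3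
    ext i
    refine (congrFun hu3 i).trans ?_
    simp only [Finset.sum_apply, Pi.smul_apply, smul_eq_mul, Matrix.mulVec, dotProduct, mul_comm]

/-- A random sign vector is nearly orthogonal to a given subspace with exponentially small
probability. -/
lemma pr_abs_signedSum_lt_one_le [DecidableEq ι] (U : Submodule ℝ (ι → ℝ)) :
    pr (fun ε : ι → Bool => ∀ y ∈ U, (∀ i, |y i| ≤ 1) → |signedSum univ y ε| < 1) ≤
      (1 / 2) ^ finrank ℝ U := by
  classical
  obtain ⟨f, z, hzU, hz1, hzf, -⟩ := exists_coordinate_spanner U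
  generalize finrank ℝ U = d at f z hzU hz1 hzf ⊢
  have hinj : Function.Injective f := fun j k h => by
    have := hzf k j
    rw [h, hzf k k] at this
    by_contra hne
    simp [hne] at this
  obtain ⟨q, hq⟩ : ∃ q : (ι → Bool) → Prop, ∀ ε, q ε ↔
    ∀ y ∈ U, (∀ i, |y i| ≤ 1) → |signedSum univ y ε| < 1 := ⟨_, fun _ => Iff.rfl⟩
  simp only [← hq]
  set I := univ.image f with hI
  have hIc : I.card = d := by
    rw [hI, card_image_of_injective _ hinj, card_univ, Fintype.card_fin]
  have hcard : (univ.filter q).card ≤ 2 ^ (Fintype.card ι - d) := by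
    have : Fintype.card ((Iᶜ : Finset ι) → Bool) = 2 ^ (Fintype.card ι - d) := by
      rw [Fintype.card_fun, Fintype.card_coe, card_compl, hIc, Fintype.card_bool]
    rw [← this, ← card_univ]
    refine card_le_card_of_injOn (fun ε i => ε i) (by simp) ?_
    intro ε hε ε' hε' h
    have hoff : ∀ i ∉ I, ε i = ε' i := fun i hi => congrFun h ⟨i, by simpa using hi⟩
    have hε : q ε := by simpa using hε
    have hε' : q ε' := by simpa using hε'
    have hon : ∀ j, ε (f j) = ε' (f j) := by
      intro j
      have h1 := abs_lt.1 ((hq ε).1 hε (z j) (hzU j) (hz1 j))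
      have h2 := abs_lt.1 ((hq ε').1 hε' (z j) (hzU j) (hz1 j))
      have h3 : signedSum univ (z j) ε - signedSum univ (z j) ε' =
          sgn (ε (f j)) - sgn (ε' (f j)) := by
        unfold signedSum
        rw [← sum_sub_distrib, sum_eq_single (f j)]
        · rw [hzf]; simp
        · intro i _ hi
          by_cases hiI : i ∈ I
          · obtain ⟨k, -, rfl⟩ := mem_image.1 hiI
            have : k ≠ j := fun h => hi (by rw [h])
            rw [hzf]; simp [this]
          · rw [hoff i hiI, sub_self]
        · simp
      cases h4 : ε (f j) <;> cases h5 : ε' (f j) <;> simp only [h4, h5, sgn] at h3 ⊢ <;>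
        norm_num at h3 <;> linarith
    funext i
    by_cases hi : i ∈ I
    · obtain ⟨j, -, rfl⟩ := mem_image.1 hi
      exact hon j
    · exact hoff i hi
  have hdn : d ≤ Fintype.card ι := by rw [← hIc]; exact card_le_univ _
  rw [pr_eq_card, Fintype.card_fun, Fintype.card_bool, div_le_iff₀ (by positivity)]
  calc ((univ.filter q).card : ℝ) ≤ 2 ^ (Fintype.card ι - d) := by exact_mod_cast hcard
    _ = (1 / 2) ^ d * (2 ^ d * 2 ^ (Fintype.card ι - d)) := by
      rw [← mul_assoc, ← mul_pow]; norm_num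
    _ = _ := by rw [← pow_add, Nat.add_sub_cancel' hdn]; push_cast; rfl

end Spanners

section BlockCover

open Finset Module Classical

variable {ι : Type*} [Fintype ι]

/-- `S` is covered by at most `c` boxes of radius `D` in the coordinates from `J`. -/
def Cov (S : Set (ι → ℝ)) (J : Finset ι) (D c : ℝ) : Prop :=
  ∃ N : Finset (ι → ℝ), (N.card : ℝ) ≤ c ∧ ∀ w ∈ S, ∃ w' ∈ N, ∀ i ∈ J, |w i - w' i| ≤ D

/-- A bound for separated subsets gives a cover. -/
lemma cov_of_separated_card_le {S : Set (ι → ℝ)} {J : Finset ι} {D c : ℝ} (hD : 0 ≤ D)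
    (h : ∀ N : Finset (ι → ℝ), (∀ w ∈ N, w ∈ S) →
      (∀ w ∈ N, ∀ w' ∈ N, w ≠ w' → ∃ i ∈ J, D < |w i - w' i|) → (N.card : ℝ) ≤ c) :
    Cov S J D c := by
  by_contra hcov
  have key : ∀ k : ℕ, ∃ N : Finset (ι → ℝ), (∀ w ∈ N, w ∈ S) ∧
      (∀ w ∈ N, ∀ w' ∈ N, w ≠ w' → ∃ i ∈ J, D < |w i - w' i|) ∧ N.card = k := by
    intro k
    induction k with
    | zero => exact ⟨∅, by simp⟩
    | succ k ih =>
      obtain ⟨N, hS, hsep, hN⟩ := ih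
      obtain ⟨w, hw, hfar⟩ : ∃ w ∈ S, ∀ w' ∈ N, ∃ i ∈ J, D < |w i - w' i| := by
        by_contra! hc
        exact hcov ⟨N, h N hS hsep, hc⟩
      have hwN : w ∉ N := fun hmem => by
        obtain ⟨i, -, hi⟩ := hfar w hmem
        simp at hi
        linarith
      refine ⟨insert w N, ?_, ?_, by rw [card_insert_of_notMem hwN, hN]⟩
      · intro v hv
        rcases mem_insert.1 hv with rfl | hv
        · exact hw
        · exact hS v hv
      · intro v hv v' hv' hne
        rcases mem_insert.1 hv with h1 | h1 <;> rcases mem_insert.1 hv' with h2 | h2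
        · exact absurd (h1.trans h2.symm) hne
        · rw [h1]; exact hfar v' h2
        · rw [h2]
          obtain ⟨i, hi, hlt⟩ := hfar v h1
          exact ⟨i, hi, by rwa [abs_sub_comm]⟩
        · exact hsep v h1 v' h2 hne
  obtain ⟨N, hS, hsep, hN⟩ := key (⌊c⌋₊ + 1)
  have h1 := h N hS hsep
  rw [hN] at h1
  push_cast at h1
  linarith [Nat.lt_floor_add_one c]

lemma sum_pr_le {α κ : Type*} [Fintype α] (N : Finset κ) (p : κ → α → Prop) {c : ℝ} (hc : 0 ≤ c)
    (h : ∀ ω, ∀ N' ⊆ N, (∀ u ∈ N', p u ω) → (N'.card : ℝ) ≤ c) : ∑ u ∈ N, pr (p u) ≤ c := by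
  simp only [pr_eq_sum]
  rw [← sum_div, sum_comm]
  refine div_le_of_le_mul₀ (by positivity) hc ?_
  calc _ ≤ ∑ _ω : α, c := sum_le_sum fun ω _ => by
          simpa using h ω (N.filter fun u => p u ω) (filter_subset _ _) fun u hu => (mem_filter.1 hu).2
    _ = _ := by simp [mul_comm]

/-- The linear conditions of vanishing off `b` and being orthogonal, over `b`, to sign vectors. -/
noncomputable def signConditions {κ : Type*} (b : Finset ι) (E : κ → ι → Bool) :
    (ι → ℝ) →ₗ[ℝ] (((bᶜ : Finset ι) → ℝ) × (κ → ℝ)) where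
  toFun y := (fun i => y i, fun k => signedSum b y (E k))
  map_add' y y' := by
    ext <;> simp [signedSum, mul_add, sum_add_distrib]
  map_smul' a y := by
    ext k
    · simp
    · simp [signedSum_smul]

lemma mem_ker_signConditions {κ : Type*} {b : Finset ι} {E : κ → ι → Bool} {y : ι → ℝ} :
    y ∈ LinearMap.ker (signConditions b E) ↔
      (∀ i ∉ b, y i = 0) ∧ ∀ k, signedSum b y (E k) = 0 := by
  simp [signConditions, funext_iff]

lemma finrank_prod_conditions {κ : Type*} [Fintype κ] (b : Finset ι) :
    finrank ℝ (((bᶜ : Finset ι) → ℝ) × (κ → ℝ)) = Fintype.card ι - b.card + Fintype.card κ := by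
  rw [finrank_prod, finrank_fintype_fun_eq_card, finrank_fintype_fun_eq_card, Fintype.card_coe,
    card_compl]

lemma le_finrank_ker_signConditions {κ : Type*} [Fintype κ] (b : Finset ι) (E : κ → ι → Bool) :
    b.card ≤ finrank ℝ (LinearMap.ker (signConditions b E)) + Fintype.card κ := by
  have h1 := (signConditions b E).finrank_range_add_finrank_ker
  have h2 := (LinearMap.range (signConditions b E)).finrank_le
  rw [finrank_prod_conditions] at h2
  rw [finrank_fintype_fun_eq_card] at h1
  have := card_le_univ b
  lia

lemma signedSum_eq_univ {b : Finset ι} {y : ι → ℝ} (hy : ∀ i ∉ b, y i = 0) (ε : ι → Bool) :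
    signedSum univ y ε = signedSum b y ε :=
  (sum_subset (subset_univ b) fun i _ hi => by rw [hy i hi, mul_zero]).symm

/-- There is a bounded vector on `b` orthogonal to all sign vectors except the `k`-th one. -/
def HasDual {κ : Type*} (b : Finset ι) (E : κ → ι → Bool) (k : κ) : Prop :=
  ∃ y : ι → ℝ, (∀ i ∉ b, y i = 0) ∧ (∀ i, |y i| ≤ 1) ∧
    (∀ l, l ≠ k → signedSum b y (E l) = 0) ∧ 1 ≤ |signedSum b y (E k)|

lemma HasDual.exists_eq_one {ι κ : Type*} {b : Finset ι} {E : κ → ι → Bool} {k : κ}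
    (h : HasDual b E k) : ∃ y : ι → ℝ, (∀ i ∉ b, y i = 0) ∧ (∀ i, |y i| ≤ 1) ∧
      ∀ l, signedSum b y (E l) = if l = k then 1 else 0 := by
  obtain ⟨y, h0, h1, h2, h3⟩ := h
  set t := signedSum b y (E k)
  have ht : t ≠ 0 := abs_pos.1 (zero_lt_one.trans_le h3)
  refine ⟨t⁻¹ • y, fun i hi => by simp [h0 i hi], fun i => ?_, fun l => ?_⟩
  · rw [Pi.smul_apply, smul_eq_mul, abs_mul, abs_inv]
    exact mul_le_one₀ (inv_le_one_of_one_le₀ h3) (abs_nonneg _) (h1 i)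
  · rw [signedSum_smul]
    split_ifs with hl
    · rw [hl]; exact inv_mul_cancel₀ ht
    · rw [h2 l hl, mul_zero]

lemma pr_not_hasDual_update_le {κ : Type*} [Fintype κ] {b : Finset ι} {h : ℕ}
    (hb : Fintype.card κ + h ≤ b.card) (E : κ → ι → Bool) (k : κ) :
    pr (fun ε => ¬ HasDual b (Function.update E k ε) k) ≤ (1 / 2) ^ (h + 1) := by
  set E' : {l // l ≠ k} → ι → Bool := fun l => E l
  have h1 := le_finrank_ker_signConditions b E'
  have h2 : Fintype.card {l // l ≠ k} = Fintype.card κ - 1 := Set.card_ne_eq k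
  have h3 : 0 < Fintype.card κ := Fintype.card_pos_iff.2 ⟨k⟩
  refine le_trans (pr_mono fun ε hε => ?_)
    ((pr_abs_signedSum_lt_one_le (LinearMap.ker (signConditions b E'))).trans
      (pow_le_pow_of_le_one (by norm_num) (by norm_num) (by lia)))
  intro y hy hy1
  rw [mem_ker_signConditions] at hy
  by_contra! hge
  refine hε ⟨y, hy.1, hy1, fun l hl => ?_, ?_⟩
  · rw [Function.update_of_ne hl]
    exact hy.2 ⟨l, hl⟩
  · rw [Function.update_self]
    rwa [signedSum_eq_univ hy.1] at hge

/-- Random sign vectors drawn from a set which is not too small mostly have dual vectors. -/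
lemma half_pow_le_pr_hasDual {κ : Type*} [Fintype κ] {b : Finset ι} {h : ℕ}
    (hb : Fintype.card κ + h = b.card)
    (Q : (ι → Bool) → Prop) (hQ : (b.card : ℝ) * (1 / 2) ^ h ≤ pr Q) :
    pr Q ^ Fintype.card κ / 2 ≤
      pr (fun E : κ → ι → Bool => (∀ k, Q (E k)) ∧ ∀ k, HasDual b E k) := by
  have hP0 := pr_nonneg Q
  set m := Fintype.card κ with hm
  have hone : ∀ k : κ, pr (fun E : κ → ι → Bool => (∀ l, Q (E l)) ∧ ¬ HasDual b E k) ≤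
      pr Q ^ (m - 1) * (1 / 2) ^ (h + 1) := by
    intro k
    have h1 : pr (fun E : κ → ι → Bool => ∀ l, l ≠ k → Q (E l)) = pr Q ^ (m - 1) := by
      rw [pr_forall fun (l : κ) (ε : ι → Bool) => l ≠ k → Q ε, ← mul_prod_erase univ _ (mem_univ k)]
      have h2 : pr (fun ε : ι → Bool => k ≠ k → Q ε) = 1 := by
        unfold pr
        simp
      rw [h2, one_mul, prod_congr rfl (g := fun _ => pr Q), prod_const, card_erase_of_mem (mem_univ k),
        card_univ]
      intro l hl
      simp [(mem_erase.1 hl).1]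
    calc _ ≤ pr (fun E : κ → ι → Bool => (∀ l, l ≠ k → Q (E l)) ∧ ¬ HasDual b E k) :=
          pr_mono fun E hE => ⟨fun l _ => hE.1 l, hE.2⟩
      _ ≤ _ := by
        rw [pr_update k, pr_prod, ← h1, pr_eq_sum, div_mul_eq_mul_div, sum_mul]
        gcongr with E hE
        dsimp only
        by_cases hE' : ∀ l, l ≠ k → Q (E l)
        · rw [if_pos hE', one_mul]
          exact (pr_mono fun ε hε => hε.2).trans
            (pr_not_hasDual_update_le (by exact hb.le) E k)
        · rw [if_neg hE', zero_mul]
          apply le_of_eq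
          have : ∀ ε, ¬ ((∀ l, l ≠ k → Q (Function.update E k ε l)) ∧
              ¬ HasDual b (Function.update E k ε) k) := fun ε hε => hE' fun l hl => by
            have := hε.1 l hl
            rwa [Function.update_of_ne hl] at this
          unfold pr
          simp [this]
  have hall : pr (fun E : κ → ι → Bool => ∀ k, Q (E k)) = pr Q ^ m := by
    rw [pr_forall fun (_ : κ) => Q]; simp [hm]
  have hsplit : pr Q ^ m ≤ pr (fun E : κ → ι → Bool => (∀ k, Q (E k)) ∧ ∀ k, HasDual b E k) +
      ∑ k : κ, pr (fun E : κ → ι → Bool => (∀ l, Q (E l)) ∧ ¬ HasDual b E k) := by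
    rw [← hall]
    refine (pr_mono fun E hE => ?_).trans ((pr_or_le _ _).trans
      (add_le_add_right (pr_exists_le univ fun k (E : κ → ι → Bool) =>
        (∀ l, Q (E l)) ∧ ¬ HasDual b E k) _))
    by_cases hd : ∀ k, HasDual b E k
    · exact Or.inl ⟨hE, hd⟩
    · push Not at hd
      exact Or.inr (hd.imp fun k hk => ⟨mem_univ _, hE, hk⟩)
  have hsum : ∑ k : κ, pr (fun E : κ → ι → Bool => (∀ l, Q (E l)) ∧ ¬ HasDual b E k) ≤
      pr Q ^ m / 2 := by
    refine (sum_le_sum fun k _ => hone k).trans ?_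
    rw [sum_const, card_univ, nsmul_eq_mul, ← hm]
    rcases Nat.eq_zero_or_pos m with h0 | hm
    · simp [h0]
    have hmb : (m : ℝ) ≤ b.card := by exact_mod_cast (by lia : m ≤ b.card)
    have : (m : ℝ) * (1 / 2) ^ h ≤ pr Q := le_trans (by gcongr) hQ
    calc (m : ℝ) * (pr Q ^ (m - 1) * (1 / 2) ^ (h + 1)) =
        pr Q ^ (m - 1) * (m * (1 / 2) ^ h) / 2 := by rw [pow_succ]; ring
      _ ≤ pr Q ^ (m - 1) * pr Q / 2 := by gcongr
      _ = _ := by rw [← pow_succ, Nat.sub_add_cancel hm]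
  linarith

lemma finrank_ker_signConditions {κ : Type*} [Fintype κ] {b : Finset ι} {h : ℕ}
    (hb : Fintype.card κ + h = b.card) {E : κ → ι → Bool} (hE : ∀ k, HasDual b E k) :
    finrank ℝ (LinearMap.ker (signConditions b E)) = h := by
  choose y hy0 hy1 hyE using fun k => (hE k).exists_eq_one
  have hsurj : LinearMap.range (signConditions b E) = ⊤ := by
    rw [LinearMap.range_eq_top]
    rintro ⟨a, c⟩
    refine ⟨(fun i => if hi : i ∈ b then 0 else a ⟨i, by simpa using hi⟩) + ∑ k, c k • y k, ?_⟩
    rw [map_add, map_sum]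
    ext i
    · have hi := mem_compl.1 i.2
      simp [signConditions, hi, hy0 _ _ hi, Prod.fst_sum]
    · simp only [signConditions, LinearMap.coe_mk, AddHom.coe_mk, Prod.snd_add, Prod.snd_sum,
        Pi.add_apply, Finset.sum_apply, signedSum_smul, hyE]
      rw [signedSum, sum_eq_zero]
      · simp
      · intro j hj
        simp [hj]
  have h1 := (signConditions b E).finrank_range_add_finrank_ker
  rw [hsurj, finrank_top, finrank_prod_conditions, finrank_fintype_fun_eq_card] at h1
  have := card_le_univ b
  lia

lemma floor_mem_Icc {x : ℝ} {L : ℕ} (h : |x| ≤ L) : ⌊x⌋ ∈ Finset.Icc (-(L : ℤ)) L := by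
  rw [abs_le] at h
  rw [mem_Icc]
  refine ⟨Int.le_floor.2 (by push_cast; exact h.1), ?_⟩
  have := (Int.floor_le x).trans h.2
  exact_mod_cast this

/-- Separated vectors whose signed sums agree, for many independent sign vectors, up to a bounded
error are few. -/
lemma card_le_of_hasDual {κ : Type*} [Fintype κ] {b : Finset ι} {h L : ℕ}
    (hb : Fintype.card κ + h = b.card) {E : κ → ι → Bool} (hE : ∀ k, HasDual b E k)
    (N : Finset (ι → ℝ)) (x : (ι → ℝ) → ℝ) (hN : ∀ w ∈ N, ∀ i ∈ b, |w i| ≤ L)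
    (hx : ∀ w ∈ N, |x w| ≤ Fintype.card ι * L + 1)
    (hclose : ∀ w ∈ N, ∀ k, |signedSum b w (E k) - x w| ≤ 1)
    (hsep : ∀ w ∈ N, ∀ w' ∈ N, w ≠ w' →
      ∃ i ∈ b, (4 * (Fintype.card ι + 1) ^ 2 : ℝ) < |w i - w' i|) :
    N.card ≤ (2 * (Fintype.card ι * L + L + 1) + 1) ^ (h + 1) := by
  choose y hy0 hy1 hyE using fun k => (hE k).exists_eq_one
  have hfin := finrank_ker_signConditions hb hE
  set K := LinearMap.ker (signConditions b E) with hK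
  have hspan := exists_coordinate_spanner K
  rw [hfin] at hspan
  obtain ⟨f, z, hzK, hz1, -, hz⟩ := hspan
  set n := Fintype.card ι
  set Z := n * L + L + 1 with hZ
  set code : (ι → ℝ) → (Fin h → ℤ) × ℤ :=
    fun w => (fun j => if f j ∈ b then ⌊w (f j)⌋ else 0, ⌊x w⌋) with hcode
  set T : Finset ((Fin h → ℤ) × ℤ) :=
    (Fintype.piFinset fun _ => Finset.Icc (-(Z : ℤ)) Z) ×ˢ Finset.Icc (-(Z : ℤ)) Z with hT
  have hTc : T.card = (2 * Z + 1) ^ (h + 1) := by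
    rw [hT, card_product, Fintype.card_piFinset_const, Int.card_Icc, pow_succ]
    congr <;> lia
  rw [← hTc]
  refine card_le_card_of_injOn code ?_ ?_
  · intro w hw
    have hLZ : (L : ℝ) ≤ Z := by
      rw [hZ]; push_cast; nlinarith [Nat.cast_nonneg (α := ℝ) n, Nat.cast_nonneg (α := ℝ) L]
    simp only [hcode, hT, coe_product, Set.mem_prod, mem_coe, Fintype.mem_piFinset]
    refine ⟨fun j => ?_, floor_mem_Icc ((hx w hw).trans ?_)⟩
    · split_ifs with hj
      · exact floor_mem_Icc ((hN w hw _ hj).trans hLZ)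
      · simp
    · rw [hZ]; push_cast; nlinarith [Nat.cast_nonneg (α := ℝ) n, Nat.cast_nonneg (α := ℝ) L]
  · intro w hw w' hw' heq
    by_contra hne
    obtain ⟨i, hi, hlt⟩ := hsep w hw w' hw' hne
    simp only [hcode, Prod.mk.injEq] at heq
    obtain ⟨hc1, hc2⟩ := heq
    set u : ι → ℝ := fun i => if i ∈ b then w i - w' i else 0 with hu
    have hxx := (Int.abs_sub_lt_one_of_floor_eq_floor hc2).le
    set t : κ → ℝ := fun k => signedSum b u (E k) with ht
    have ht3 : ∀ k, |t k| ≤ 3 := by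
      intro k
      have h1 : t k = signedSum b w (E k) - signedSum b w' (E k) := by
        rw [← signedSum_sub]
        exact signedSum_congr (fun j hj => by simp [hu, hj]) fun _ _ => rfl
      have h2 := abs_le.1 (hclose w hw k)
      have h3 := abs_le.1 (hclose w' hw' k)
      have h4 := abs_le.1 hxx
      rw [h1, abs_le]
      constructor <;> linarith
    set v : ι → ℝ := ∑ k, t k • y k with hv
    have hvb : ∀ j, |v j| ≤ 3 * Fintype.card κ := by
      intro j
      rw [hv, Finset.sum_apply]
      refine (abs_sum_le_sum_abs _ _).trans ((sum_le_card_nsmul univ _ 3 fun k _ => ?_).trans ?_)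
      · rw [Pi.smul_apply, smul_eq_mul, abs_mul]
        nlinarith [ht3 k, hy1 k j, abs_nonneg (y k j), abs_nonneg (t k)]
      · rw [nsmul_eq_mul, mul_comm, card_univ]
    have hvs : ∀ k, signedSum b v (E k) = t k := by
      intro k
      have : signedSum b v (E k) = ∑ l, t l * signedSum b (y l) (E k) := by
        simp only [signedSum, hv, Finset.sum_apply, Pi.smul_apply, smul_eq_mul, mul_sum]
        rw [sum_comm]
        exact sum_congr rfl fun _ _ => sum_congr rfl fun _ _ => by ring
      simp [this, hyE]
    have huK : u - v ∈ K := by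
      rw [hK, mem_ker_signConditions]
      refine ⟨fun j hj => ?_, fun k => by rw [signedSum_sub, hvs, sub_self]⟩
      simp [hu, hv, hj, hy0 _ _ hj]
    have hcoord : ∀ j, |(u - v) (f j)| ≤ 1 + 3 * Fintype.card κ := by
      intro j
      rw [Pi.sub_apply]
      refine (abs_sub _ _).trans (add_le_add ?_ (hvb _))
      by_cases hj : f j ∈ b
      · have := congrFun hc1 j
        simp only [hj, if_true] at this
        simp only [hu, hj, if_true]
        exact (Int.abs_sub_lt_one_of_floor_eq_floor this).le
      · simp [hu, hj]
    have hui : |(u - v) i| ≤ h * (1 + 3 * Fintype.card κ) := by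
      rw [hz _ huK, Finset.sum_apply]
      refine (abs_sum_le_sum_abs _ _).trans
        ((sum_le_card_nsmul univ _ (1 + 3 * (Fintype.card κ : ℝ)) fun j _ => ?_).trans ?_)
      · rw [Pi.smul_apply, smul_eq_mul, abs_mul]
        exact (mul_le_of_le_one_right (abs_nonneg _) (hz1 j i)).trans (hcoord j)
      · rw [nsmul_eq_mul, card_univ, Fintype.card_fin]
    have hfinal : |w i - w' i| ≤ h * (1 + 3 * Fintype.card κ) + 3 * Fintype.card κ := by
      have h1 : w i - w' i = (u - v) i + v i := by simp [hu, hi]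
      rw [h1]
      exact (abs_add_le _ _).trans (add_le_add hui (hvb i))
    have hsum : (Fintype.card κ : ℝ) + h ≤ n := by
      have := hb.le.trans (card_le_univ b)
      exact_mod_cast this
    have hh0 : (0 : ℝ) ≤ h := Nat.cast_nonneg _
    have hk0 : (0 : ℝ) ≤ Fintype.card κ := Nat.cast_nonneg _
    nlinarith [mul_nonneg hh0 hk0]

/-- The vectors bounded by `L` which are rich on a block admit an efficient cover on that
block. -/
lemma cov_rich_block {κ : Type*} [Fintype κ] {b : Finset ι} {h L : ℕ} {q : ℝ}
    (hb : Fintype.card κ + h = b.card) (hq : 0 < q) (hbq : (b.card : ℝ) * (1 / 2) ^ h ≤ q) :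
    Cov {w | (∀ i ∈ b, |w i| ≤ L) ∧ Rich b w 1 q} b (4 * (Fintype.card ι + 1) ^ 2)
      (2 * (2 * (Fintype.card ι * L + L + 1) + 1) ^ (h + 1) / q ^ Fintype.card κ) := by
  refine cov_of_separated_card_le (by positivity) fun N hN hsep => ?_
  have hx : ∀ w, ∃ x, w ∈ N → q < pr fun ε => |signedSum b w ε - x| ≤ 1 := by
    intro w
    by_cases hw : w ∈ N
    · obtain ⟨x, hx⟩ := (hN w hw).2
      exact ⟨x, fun _ => hx⟩
    · exact ⟨0, fun h => absurd h hw⟩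
  choose x hx using hx
  have hxb : ∀ w ∈ N, |x w| ≤ Fintype.card ι * L + 1 := by
    intro w hw
    obtain ⟨ε, hε⟩ : ∃ ε, |signedSum b w ε - x w| ≤ 1 := by
      by_contra! hcon
      have h1 := hx w hw
      have : pr (fun ε => |signedSum b w ε - x w| ≤ 1) = 0 := by
        unfold pr
        simp [fun ε => not_le.2 (hcon ε)]
      linarith
    have h1 := abs_signedSum_le (hN w hw).1 ε
    have h2 : (b.card : ℝ) * L ≤ Fintype.card ι * L := by
      gcongr
      exact card_le_univ b
    rw [abs_le] at *
    constructor <;> linarith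
  have hlow : (N.card : ℝ) * (q ^ Fintype.card κ / 2) ≤
      ∑ w ∈ N, pr (fun E : κ → ι → Bool =>
        (∀ k, |signedSum b w (E k) - x w| ≤ 1) ∧ ∀ k, HasDual b E k) := by
    rw [← nsmul_eq_mul]
    refine card_nsmul_le_sum _ _ _ fun w hw => ?_
    refine le_trans ?_ (half_pow_le_pr_hasDual hb (fun ε => |signedSum b w ε - x w| ≤ 1)
      (hbq.trans (hx w hw).le))
    gcongr
    exact (hx w hw).le
  have hup := sum_pr_le N (fun w (E : κ → ι → Bool) =>
    (∀ k, |signedSum b w (E k) - x w| ≤ 1) ∧ ∀ k, HasDual b E k)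
    (c := (2 * (Fintype.card ι * L + L + 1) + 1) ^ (h + 1)) (by positivity)
    fun E N' hN' hE => by
      rcases N'.eq_empty_or_nonempty with rfl | ⟨w₀, hw₀⟩
      · simp only [card_empty, Nat.cast_zero]
        positivity
      · exact_mod_cast card_le_of_hasDual (L := L) hb (hE w₀ hw₀).2 N' x
          (fun w hw => (hN w (hN' hw)).1) (fun w hw => hxb w (hN' hw)) (fun w hw => (hE w hw).1)
          fun w hw w' hw' => hsep w (hN' hw) w' (hN' hw')
  rw [le_div_iff₀ (by positivity)]
  linarith

end BlockCover

section Covers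

open Finset Classical

variable {ι : Type*}

lemma Cov.mono {S S' : Set (ι → ℝ)} {J : Finset ι} {D c c' : ℝ} (h : Cov S J D c) (hS : S' ⊆ S)
    (hc : c ≤ c') : Cov S' J D c' := by
  obtain ⟨N, hN, hcov⟩ := h
  exact ⟨N, hN.trans hc, fun w hw => hcov w (hS hw)⟩

lemma Cov.union_index {S T : Set (ι → ℝ)} {J K : Finset ι} {D c d : ℝ} (h : Cov S J D c)
    (h' : Cov T K D d) : Cov (S ∩ T) (J ∪ K) D (c * d) := by
  obtain ⟨N, hN, hcov⟩ := h
  obtain ⟨M, hM, hcov'⟩ := h'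
  refine ⟨(N ×ˢ M).image fun x => J.piecewise x.1 x.2, ?_, fun w hw => ?_⟩
  · refine (Nat.cast_le.2 card_image_le).trans ?_
    rw [card_product, Nat.cast_mul]
    exact mul_le_mul hN hM (Nat.cast_nonneg _) ((Nat.cast_nonneg _).trans hN)
  · obtain ⟨u, hu, hwu⟩ := hcov w hw.1
    obtain ⟨v, hv, hwv⟩ := hcov' w hw.2
    refine ⟨J.piecewise u v, mem_image.2 ⟨(u, v), mem_product.2 ⟨hu, hv⟩, rfl⟩, fun i hi => ?_⟩
    by_cases hiJ : i ∈ J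
    · simpa [hiJ] using hwu i hiJ
    · simpa [hiJ] using hwv i ((mem_union.1 hi).resolve_left hiJ)

lemma Cov.biUnion {κ : Type*} (F : Finset κ) (S : κ → Set (ι → ℝ)) {J : Finset ι} {D : ℝ}
    (c : κ → ℝ) (h : ∀ b ∈ F, Cov (S b) J D (c b)) :
    Cov {w | ∃ b ∈ F, w ∈ S b} J D (∑ b ∈ F, c b) := by
  choose! N hN hcov using h
  refine ⟨F.biUnion N, ?_, ?_⟩
  · refine (Nat.cast_le.2 card_biUnion_le).trans ?_
    rw [Nat.cast_sum]
    exact sum_le_sum hN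
  · rintro w ⟨b, hb, hw⟩
    obtain ⟨w', hw', h⟩ := hcov b hb w hw
    exact ⟨w', mem_biUnion.2 ⟨b, hb, hw'⟩, h⟩

lemma cov_zero {J : Finset ι} {D : ℝ} (hD : 1 ≤ D) : Cov {w | ∀ i ∈ J, |w i| ≤ 1} J D 1 :=
  ⟨{0}, by simp, fun w hw => ⟨0, by simp, fun i hi => by simpa using (hw i hi).trans hD⟩⟩

variable [Fintype ι]

lemma cov_grid {J : Finset ι} {L : ℕ} {D : ℝ} (hD : 1 ≤ D) :
    Cov {w | ∀ i ∈ J, |w i| ≤ L} J D ((2 * L + 1) ^ J.card) := by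
  set T : Finset (ι → ℤ) :=
    Fintype.piFinset fun i => if i ∈ J then Finset.Icc (-(L : ℤ)) L else {0} with hT
  have hTc : T.card = (2 * L + 1) ^ J.card := by
    rw [hT, Fintype.card_piFinset]
    have : ∀ i, (if i ∈ J then Finset.Icc (-(L : ℤ)) L else {0}).card =
        if i ∈ J then 2 * L + 1 else 1 := fun i => by
      split_ifs
      · rw [Int.card_Icc]; lia
      · simp
    simp [this]
  refine ⟨T.image fun g i => (g i : ℝ), ?_, fun w hw => ?_⟩
  · refine (Nat.cast_le.2 card_image_le).trans (le_of_eq ?_)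
    rw [hTc]
    push_cast
    rfl
  · refine ⟨fun i => ((if i ∈ J then ⌊w i⌋ else 0 : ℤ) : ℝ),
      mem_image.2 ⟨fun i => if i ∈ J then ⌊w i⌋ else 0, ?_, rfl⟩, fun i hi => ?_⟩
    · rw [hT, Fintype.mem_piFinset]
      intro i
      by_cases hi : i ∈ J
      · simpa only [hi, if_true] using floor_mem_Icc (hw i hi)
      · simp [hi]
    · simp only [hi, if_true]
      rw [Int.self_sub_floor, abs_of_nonneg (Int.fract_nonneg _)]
      exact (Int.fract_lt_one _).le.trans hD

/-- The vectors with all coordinates large on `J` which are rich on `J` admit an efficient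
cover. -/
lemma cov_rich_large {s j h L Λ : ℕ} {p q : ℝ} (hs : 100 ≤ s) (hh : h ≤ s)
    (hΛ : Λ = 2 * (Fintype.card ι * L + L + 1) + 1) (hq : q = p * (1000 / 999) ^ j) (hp : 0 < p)
    (hq1 : q ≤ 1) (hpow : 3 ^ j * (2 * Λ ^ (h + 1)) ≤ 2 ^ s)
    (hn : (Fintype.card ι : ℝ) * (1 / 2) ^ h ≤ q) (J : Finset ι) :
    Cov {w | (∀ i ∈ J, 1 < |w i| ∧ |w i| ≤ L) ∧ Rich J w 1 p} J (4 * (Fintype.card ι + 1) ^ 2)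
      (Λ ^ (s * 3 ^ j) * (2 / q) ^ J.card) := by
  have hq0 : 0 < q := by rw [hq]; positivity
  have hΛ1 : (2 * L + 1 : ℝ) ≤ Λ := by
    have : 2 * L + 1 ≤ Λ := by rw [hΛ]; nlinarith [Nat.zero_le (Fintype.card ι * L)]
    exact_mod_cast this
  have hq2 : 1 ≤ 2 / q := by rw [le_div_iff₀ hq0]; linarith
  induction hk : J.card using Nat.strong_induction_on generalizing J with
  | _ k ih =>
    rcases lt_or_ge J.card (s * 3 ^ j) with hlt | hge
    · refine (cov_grid (L := L) (J := J) ?_).mono (fun w hw i hi => (hw.1 i hi).2) ?_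
      · nlinarith [Nat.cast_nonneg (α := ℝ) (Fintype.card ι)]
      · calc (2 * L + 1 : ℝ) ^ J.card ≤ (Λ : ℝ) ^ J.card := by gcongr
          _ ≤ (Λ : ℝ) ^ (s * 3 ^ j) := pow_le_pow_right₀ (by
              linarith [Nat.cast_nonneg (α := ℝ) L]) hlt.le
          _ ≤ _ := le_mul_of_one_le_right (by positivity) (one_le_pow₀ hq2)
    · obtain ⟨F, hF, hFb, hFw⟩ := exists_block_family hs j J hge
      set C : ℝ := Λ ^ (s * 3 ^ j) * (2 / q) ^ k with hC
      have hblock : ∀ b ∈ F, Cov {w | (∀ i ∈ J, 1 < |w i| ∧ |w i| ≤ L) ∧ Rich J w 1 p ∧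
          Rich b w 1 q} J (4 * (Fintype.card ι + 1) ^ 2) (C / 3 ^ j) := by
        intro b hb
        obtain ⟨hbJ, hbs⟩ := hFb b hb
        have hbJc := card_le_card hbJ
        have hcard : (J \ b).card = k - b.card := by rw [card_sdiff_of_subset hbJ, hk]
        have h1 := cov_rich_block (κ := Fin (b.card - h)) (b := b) (h := h) (L := L) (q := q)
          (by rw [Fintype.card_fin]; lia) hq0 (le_trans (by
            gcongr; exact card_le_univ b) hn)
        have h2 := ih (k - b.card) (by lia) (J \ b) hcard
        have h3 := h1.union_index h2
        rw [union_sdiff_of_subset hbJ] at h3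
        refine h3.mono (fun w hw => ⟨⟨fun i hi => (hw.1 i (hbJ hi)).2, hw.2.2⟩,
          fun i hi => hw.1 i (sdiff_subset hi), rich_subset sdiff_subset hw.2.1⟩) ?_
        have h4 : (2 * (2 * (Fintype.card ι * L + L + 1) + 1) ^ (h + 1) : ℝ) ≤ 2 ^ s / 3 ^ j := by
          rw [le_div_iff₀ (by positivity), mul_comm]
          have := hpow
          rw [hΛ] at this
          exact_mod_cast this
        rw [Fintype.card_fin, hC, le_div_iff₀ (by positivity)]
        have h5 : (2 : ℝ) ^ s ≤ 2 ^ b.card := pow_le_pow_right₀ (by norm_num) hbs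
        have h6 : q ^ b.card ≤ q ^ (b.card - h) := pow_le_pow_of_le_one hq0.le hq1 (Nat.sub_le _ _)
        have h7 : (2 / q) ^ k = (2 / q) ^ b.card * (2 / q) ^ (k - b.card) := by
          rw [← pow_add]; congr 1; lia
        calc _ ≤ 2 ^ s / 3 ^ j / q ^ b.card *
              ((Λ : ℝ) ^ (s * 3 ^ j) * (2 / q) ^ (k - b.card)) * 3 ^ j := by gcongr
          _ = 2 ^ s / q ^ b.card * ((Λ : ℝ) ^ (s * 3 ^ j) * (2 / q) ^ (k - b.card)) := by
            field_simp
          _ ≤ 2 ^ b.card / q ^ b.card * ((Λ : ℝ) ^ (s * 3 ^ j) * (2 / q) ^ (k - b.card)) := by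
            gcongr
          _ = _ := by rw [h7, div_pow]; ring
      refine (Cov.biUnion F _ _ hblock).mono (fun w hw => ?_) ?_
      · obtain ⟨b, hb, hr⟩ := hFw w (fun i hi => (hw.1 i hi).1) p hw.2
        exact ⟨b, hb, hw.1, hw.2, hq ▸ hr⟩
      · rw [sum_const, nsmul_eq_mul]
        have : (F.card : ℝ) ≤ 3 ^ j := by exact_mod_cast hF
        calc (F.card : ℝ) * (C / 3 ^ j) ≤ 3 ^ j * (C / 3 ^ j) := by gcongr
          _ = C := by field_simp

/-- The bounded vectors which are rich admit an efficient cover. -/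
lemma cov_rich {s j h L Λ : ℕ} {p q : ℝ} (hs : 100 ≤ s) (hh : h ≤ s)
    (hΛ : Λ = 2 * (Fintype.card ι * L + L + 1) + 1) (hq : q = p * (1000 / 999) ^ j) (hp : 0 < p)
    (hq1 : q ≤ 1) (hpow : 3 ^ j * (2 * Λ ^ (h + 1)) ≤ 2 ^ s)
    (hn : (Fintype.card ι : ℝ) * (1 / 2) ^ h ≤ q) :
    Cov {w : ι → ℝ | (∀ i, |w i| ≤ L) ∧ Rich univ w 1 p} univ (4 * (Fintype.card ι + 1) ^ 2)
      (Λ ^ (s * 3 ^ j) * (2 / q + 1) ^ Fintype.card ι) := by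
  have hD : (1 : ℝ) ≤ 4 * (Fintype.card ι + 1) ^ 2 := by
    nlinarith [Nat.cast_nonneg (α := ℝ) (Fintype.card ι)]
  have h1 : ∀ H ∈ (univ : Finset ι).powerset,
      Cov {w : ι → ℝ | ((∀ i, |w i| ≤ L) ∧ Rich univ w 1 p) ∧ ∀ i, i ∈ H ↔ 1 < |w i|} univ
        (4 * (Fintype.card ι + 1) ^ 2)
        (Λ ^ (s * 3 ^ j) * ((2 / q) ^ H.card * 1 ^ ((univ : Finset ι).card - H.card))) := by
    intro H _
    have := (cov_rich_large hs hh hΛ hq hp hq1 hpow hn H).union_index (cov_zero (J := Hᶜ) hD)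
    rw [union_compl] at this
    refine this.mono (fun w hw => ⟨⟨fun i hi => ⟨(hw.2 i).1 hi, hw.1.1 i⟩,
      rich_subset (subset_univ _) hw.1.2⟩, fun i hi => ?_⟩) (by simp)
    rw [mem_compl, hw.2 i, not_lt] at hi
    exact hi
  refine (Cov.biUnion _ _ _ h1).mono (fun w hw => ?_) (le_of_eq ?_)
  · exact ⟨univ.filter fun i => 1 < |w i|, by simp, hw, by simp⟩
  · rw [← mul_sum, sum_pow_mul_eq_add_pow, card_univ]

lemma card_filter_card_le (τ : ℕ) :
    ((univ : Finset (Finset ι)).filter fun H => H.card ≤ τ).card ≤ (Fintype.card ι + 1) ^ τ := by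
  have : ((univ : Finset (Finset ι)).filter fun H => H.card ≤ τ) ⊆
      (univ : Finset (Fin τ → Option ι)).image
        fun g => univ.filter fun i => ∃ t, g t = some i := by
    intro H hH
    have hτ := (mem_filter.1 hH).2
    refine mem_image.2 ⟨fun t => if ht : (t : ℕ) < H.card then some (H.equivFin.symm ⟨t, ht⟩)
      else none, mem_univ _, ?_⟩
    ext i
    simp only [mem_filter, mem_univ, true_and]
    constructor
    · rintro ⟨t, ht⟩
      split_ifs at ht with htc
      rw [← Option.some.inj ht]
      exact (H.equivFin.symm ⟨t, htc⟩).2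
    · intro hi
      have hlt := (H.equivFin ⟨i, hi⟩).2
      refine ⟨⟨H.equivFin ⟨i, hi⟩, hlt.trans_le hτ⟩, ?_⟩
      simp
  refine (card_le_card this).trans (card_image_le.trans ?_)
  simp

/-- The cover of the bounded rich vectors when the concentration is so large that few coordinates
can exceed one. -/
lemma cov_very_rich {s j L Λ : ℕ} {p : ℝ} (hs : 100 ≤ s) (hL : 1 ≤ L)
    (hΛ : Λ = 2 * (Fintype.card ι * L + L + 1) + 1) (hq1 : 1 ≤ p * (1000 / 999) ^ j) :
    Cov {w : ι → ℝ | (∀ i, |w i| ≤ L) ∧ Rich univ w 1 p} univ (4 * (Fintype.card ι + 1) ^ 2)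
      (Λ ^ (2 * (s * 3 ^ j))) := by
  have hD : (1 : ℝ) ≤ 4 * (Fintype.card ι + 1) ^ 2 := by
    nlinarith [Nat.cast_nonneg (α := ℝ) (Fintype.card ι)]
  set τ := s * 3 ^ j with hτ
  have hΛ1 : (2 * L + 1 : ℝ) ≤ Λ := by
    have : 2 * L + 1 ≤ Λ := by rw [hΛ]; nlinarith [Nat.zero_le (Fintype.card ι * L)]
    exact_mod_cast this
  have hΛ2 : (Fintype.card ι + 1 : ℝ) ≤ Λ := by
    have : Fintype.card ι + 1 ≤ Λ := by
      rw [hΛ]; nlinarith [Nat.mul_le_mul_left (Fintype.card ι) hL]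
    exact_mod_cast this
  have h1 : ∀ H ∈ (univ : Finset (Finset ι)).filter fun H => H.card ≤ τ,
      Cov {w : ι → ℝ | ((∀ i, |w i| ≤ L) ∧ Rich univ w 1 p) ∧ ∀ i, i ∈ H ↔ 1 < |w i|} univ
        (4 * (Fintype.card ι + 1) ^ 2) ((Λ : ℝ) ^ τ) := by
    intro H hH
    have := (cov_grid (J := H) (L := L) hD).union_index (cov_zero (J := Hᶜ) hD)
    rw [union_compl] at this
    refine this.mono (fun w hw => ⟨fun i hi => hw.1.1 i, fun i hi => ?_⟩) ?_
    · rw [mem_compl, hw.2 i, not_lt] at hi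
      exact hi
    · rw [mul_one]
      calc (2 * L + 1 : ℝ) ^ H.card ≤ (Λ : ℝ) ^ H.card := by gcongr
        _ ≤ _ := pow_le_pow_right₀ (by linarith [Nat.cast_nonneg (α := ℝ) L])
          (mem_filter.1 hH).2
  refine (Cov.biUnion _ _ _ h1).mono (fun w hw => ?_) ?_
  · refine ⟨univ.filter fun i => 1 < |w i|, ?_, hw, by simp⟩
    simp only [mem_filter, mem_univ, true_and]
    by_contra! hlt
    obtain ⟨F, -, -, hFw⟩ := exists_block_family hs j (univ.filter fun i => 1 < |w i|) hlt.le
    obtain ⟨b, -, hr⟩ := hFw w (by simp) p (rich_subset (subset_univ _) hw.2)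
    exact absurd hr.lt_one (not_lt.2 hq1)
  · rw [sum_const, nsmul_eq_mul, two_mul, pow_add]
    gcongr
    calc (_ : ℝ) ≤ (Fintype.card ι + 1 : ℝ) ^ τ := by exact_mod_cast card_filter_card_le τ
      _ ≤ _ := by gcongr

end Covers

section RichKernel

open Finset Classical

variable {ι : Type*} [Fintype ι]

/-- The `i`-th entry of the product of the randomly perturbed matrix with `v`. -/
def rowDot (M : Matrix ι ι ℝ) (i : ι) (v : ι → ℝ) (ε : ι → Bool) : ℝ :=
  ∑ l, M i l * v l + signedSum univ v ε

lemma rowDot_smul (M : Matrix ι ι ℝ) (i : ι) (a : ℝ) (v : ι → ℝ) (ε : ι → Bool) :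
    rowDot M i (a • v) ε = a * rowDot M i v ε := by
  rw [rowDot, rowDot, signedSum_smul, mul_add, mul_sum]
  congr 1
  exact sum_congr rfl fun l _ => by simp; ring

lemma rowDot_sub (M : Matrix ι ι ℝ) (i : ι) (v w : ι → ℝ) (ε : ι → Bool) :
    rowDot M i (v - w) ε = rowDot M i v ε - rowDot M i w ε := by
  rw [rowDot, rowDot, rowDot, signedSum_sub]
  simp only [Pi.sub_apply, mul_sub, sum_sub_distrib]
  ring

lemma abs_rowDot_le {M : Matrix ι ι ℝ} {m D : ℝ} (hM : ∀ i l, |M i l| ≤ m) (i : ι) {v : ι → ℝ}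
    (hv : ∀ l, |v l| ≤ D) (ε : ι → Bool) :
    |rowDot M i v ε| ≤ Fintype.card ι * (m + 1) * D := by
  have h1 : |∑ l, M i l * v l| ≤ Fintype.card ι * (m * D) := by
    refine (abs_sum_le_sum_abs _ _).trans ((sum_le_card_nsmul univ _ (m * D) fun l _ => ?_).trans ?_)
    · rw [abs_mul]
      exact mul_le_mul (hM i l) (hv l) (abs_nonneg _) ((abs_nonneg _).trans (hM i l))
    · rw [nsmul_eq_mul, card_univ]
  have h2 := abs_signedSum_le (J := univ) (fun l _ => hv l) ε
  rw [card_univ] at h2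
  refine (abs_add_le _ _).trans ((add_le_add h1 h2).trans (le_of_eq ?_))
  ring

/-- If one of the weights is large, no short interval is hit with probability more than one
half. -/
lemma pr_signedSum_le_half {w : ι → ℝ} {r : ℝ} {i : ι} (hi : r < |w i|) (x : ℝ) :
    pr (fun ε => |signedSum univ w ε - x| ≤ r) ≤ 1 / 2 := by
  refine pr_update_le i _ fun s => ?_
  have hdiff : ∀ c, signedSum univ w (Function.update s i c) =
      sgn c * w i + signedSum (univ.erase i) w s := by
    intro c
    rw [signedSum, ← add_sum_erase univ _ (mem_univ i), Function.update_self]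
    congr 1
    refine sum_congr rfl fun l hl => ?_
    rw [Function.update_of_ne (mem_erase.1 hl).1]
  simp only [hdiff]
  set y := signedSum (univ.erase i) w s - x
  obtain ⟨Q, hQ⟩ : ∃ Q : Bool → Prop, ∀ c, Q c ↔
    |sgn c * w i + signedSum (univ.erase i) w s - x| ≤ r := ⟨_, fun _ => Iff.rfl⟩
  simp only [← hQ]
  have hcard : (univ.filter Q).card ≤ 1 := by
    rw [card_le_one]
    intro c hc c' hc'
    have h1 := (hQ c).1 (mem_filter.1 hc).2
    have h2 := (hQ c').1 (mem_filter.1 hc').2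
    by_contra hne
    have h3 : r + r < |sgn c * w i - sgn c' * w i| := by
      have h4 : |sgn c * w i - sgn c' * w i| = 2 * |w i| := by
        rw [← sub_mul, abs_mul]
        congr 1
        cases c <;> cases c' <;> simp [sgn] at hne ⊢ <;> norm_num
      rw [h4]
      linarith
    have h5 : sgn c * w i - sgn c' * w i = (sgn c * w i + signedSum (univ.erase i) w s - x) -
        (sgn c' * w i + signedSum (univ.erase i) w s - x) := by ring
    rw [h5] at h3
    exact absurd ((abs_sub _ _).trans (add_le_add h1 h2)) (not_le.2 h3)
  rw [pr_eq_card, Fintype.card_bool, Nat.cast_two]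
  gcongr
  exact_mod_cast hcard

/-- The union bound over a cover of a set of potential kernel vectors. -/
lemma pr_exists_kernel_le {M : Matrix ι ι ℝ} {m D c P R : ℝ} {S : Set (ι → ℝ)} (b : ι)
    (hM : ∀ i l, |M i l| ≤ m) (hS : Cov S univ D c) (hP : 0 ≤ P)
    (hR : Fintype.card ι * (m + 1) * D + Fintype.card ι * D ≤ R)
    (hconc : ∀ w ∈ S, ∀ x, pr (fun ε => |signedSum univ w ε - x| ≤ R) ≤ P) :
    pr (fun E : ι → ι → Bool => ∃ w ∈ S, ∀ i, i ≠ b → rowDot M i w (E i) = 0) ≤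
      c * P ^ (Fintype.card ι - 1) := by
  obtain ⟨N, hN, hcov⟩ := hS
  set N' := N.filter fun w' => ∃ w ∈ S, ∀ i, |w i - w' i| ≤ D with hN'
  set R' := Fintype.card ι * (m + 1) * D with hR'
  have hN'c : (N'.card : ℝ) ≤ c := (Nat.cast_le.2 (card_filter_le _ _)).trans hN
  calc _ ≤ pr (fun E : ι → ι → Bool => ∃ w' ∈ N', ∀ i, i ≠ b → |rowDot M i w' (E i)| ≤ R') := by
        refine pr_mono fun E ⟨w, hw, hE⟩ => ?_
        obtain ⟨w', hw', hww⟩ := hcov w hw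
        refine ⟨w', mem_filter.2 ⟨hw', w, hw, fun i => hww i (mem_univ i)⟩, fun i hi => ?_⟩
        have h1 := abs_rowDot_le hM i (v := w - w') (fun l => hww l (mem_univ l)) (E i)
        rwa [rowDot_sub, hE i hi, zero_sub, abs_neg] at h1
    _ ≤ ∑ w' ∈ N', pr (fun E : ι → ι → Bool => ∀ i, i ≠ b → |rowDot M i w' (E i)| ≤ R') :=
        pr_exists_le N' fun w' (E : ι → ι → Bool) => ∀ i, i ≠ b → |rowDot M i w' (E i)| ≤ R'
    _ ≤ ∑ w' ∈ N', P ^ (Fintype.card ι - 1) := by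
        refine sum_le_sum fun w' hw' => ?_
        obtain ⟨w, hw, hww⟩ := (mem_filter.1 hw').2
        rw [pr_forall fun i (ε : ι → Bool) => i ≠ b → |rowDot M i w' ε| ≤ R',
          ← mul_prod_erase univ _ (mem_univ b), ← card_univ, ← card_erase_of_mem (mem_univ b),
          ← prod_const]
        refine (mul_le_of_le_one_left (prod_nonneg fun i _ => pr_nonneg _) (pr_le_one _)).trans ?_
        refine prod_le_prod (fun i _ => pr_nonneg _) fun i hi => ?_
        refine le_trans (pr_mono fun ε hε => ?_) (hconc w hw (-∑ l, M i l * w' l))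
        have h1 := hε (mem_erase.1 hi).1
        have h2 := abs_signedSum_le (J := univ) (w := w - w') (fun l _ => hww l) ε
        rw [signedSum_sub, card_univ] at h2
        rw [rowDot] at h1
        have h3 : signedSum univ w ε - -∑ l, M i l * w' l =
            (∑ l, M i l * w' l + signedSum univ w' ε) +
              (signedSum univ w ε - signedSum univ w' ε) := by ring
        rw [h3]
        exact (abs_add_le _ _).trans ((add_le_add h1 h2).trans hR)
    _ ≤ _ := by
        rw [sum_const, nsmul_eq_mul]
        gcongr

/-- The parameters of the covering argument are admissible for a given dimension, scale and
concentration. -/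
structure Admissible (n s j h L Λ l : ℕ) (m ρ θ : ℝ) : Prop where
  hn : 1 ≤ n
  hs : 100 ≤ s
  hh : h ≤ s
  hL : 1 ≤ L
  hΛ : Λ = 2 * (n * L + L + 1) + 1
  hpow : 3 ^ j * (2 * Λ ^ (h + 1)) ≤ 2 ^ s
  hθ : 0 < θ
  hθ1 : θ ≤ 1
  hh2 : (n : ℝ) * (1 / 2) ^ h ≤ θ ^ l
  hρ : 1 < ρ
  hρL : ρ ^ (l + 1) ≤ L
  hR : n * (m + 1) * (4 * (n + 1) ^ 2) + n * (4 * (n + 1) ^ 2) ≤ ρ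

lemma pr_exists_kernel_scale_le {s j h L Λ l k : ℕ} {m ρ θ : ℝ}
    (H : Admissible (Fintype.card ι) s j h L Λ l m ρ θ) (hk : k < l) {M : Matrix ι ι ℝ}
    (hM : ∀ i l, |M i l| ≤ m) (b : ι) :
    pr (fun E : ι → ι → Bool => ∃ w ∈ {w : ι → ℝ | (∀ i, |w i| ≤ L) ∧
        Rich univ w 1 (θ ^ (l - k)) ∧ ¬ Rich univ w ρ (θ ^ (l - (k + 1))) ∧ ∃ i, ρ < |w i|},
      ∀ i, i ≠ b → rowDot M i w (E i) = 0) ≤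
      Λ ^ (s * 3 ^ j) * 3 ^ Fintype.card ι / (((1000 / 999) ^ j * θ) ^ Fintype.card ι * θ ^ l) +
        Λ ^ (2 * (s * 3 ^ j)) * (1 / 2) ^ (Fintype.card ι - 1) := by
  have hθ := H.hθ
  set n := Fintype.card ι with hn
  set g : ℝ := (1000 / 999) ^ j with hg
  have hg1 : 1 ≤ g := one_le_pow₀ (by norm_num)
  set p := θ ^ (l - k) with hp
  have hp0 : 0 < p := by positivity
  have hpl : θ ^ l ≤ p := pow_le_pow_of_le_one hθ.le H.hθ1 (Nat.sub_le _ _)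
  have hp' : θ ^ (l - (k + 1)) = p / θ := by
    rw [hp, eq_div_iff hθ.ne', ← pow_succ]
    congr 1
    lia
  rw [hp']
  rcases le_total (p * g) 1 with hq | hq
  · have hcov := cov_rich H.hs H.hh H.hΛ (q := p * g) rfl hp0 hq H.hpow
      (H.hh2.trans (hpl.trans (le_mul_of_one_le_right hp0.le hg1)))
    refine (pr_exists_kernel_le b hM (hcov.mono (fun w hw => ⟨hw.1, hw.2.1⟩) le_rfl)
      (P := p / θ) (by positivity) H.hR fun w hw => not_rich_iff.1 hw.2.2.1).trans ?_
    refine le_trans ?_ (le_add_of_nonneg_right (by positivity))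
    have h3 : 2 / (p * g) + 1 ≤ 3 / (p * g) := by
      rw [div_add_one (by positivity)]
      gcongr
      linarith
    have h4 : (p / θ) ^ n = (p / θ) ^ (n - 1) * (p / θ) := by
      rw [← pow_succ, Nat.sub_add_cancel H.hn]
    have h5 : (p / θ) ^ (n - 1) ≤ (p / θ) ^ n / θ ^ l := by
      rw [h4, mul_div_assoc]
      refine le_mul_of_one_le_right (by positivity) ?_
      rw [one_le_div (by positivity)]
      refine hpl.trans ?_
      rw [le_div_iff₀ hθ]
      exact mul_le_of_le_one_right hp0.le H.hθ1
    calc _ ≤ (Λ : ℝ) ^ (s * 3 ^ j) * (3 / (p * g)) ^ n * ((p / θ) ^ n / θ ^ l) := by gcongr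
      _ = _ := by
        rw [div_pow, div_pow, mul_pow, mul_pow]
        field_simp
  · have hcov := cov_very_rich (p := p) H.hs H.hL H.hΛ hq
    refine (pr_exists_kernel_le b hM (hcov.mono (fun w hw => ⟨hw.1, hw.2.1⟩) le_rfl)
      (P := 1 / 2) (by norm_num) H.hR fun w hw x => ?_).trans
      (le_add_of_nonneg_left (by positivity))
    obtain ⟨i, hi⟩ := hw.2.2.2
    exact pr_signedSum_le_half hi x

/-- With small probability there is a kernel vector, of all but one of the rows, having
concentrated signed sums. -/
lemma pr_exists_rich_kernel_le {s j h L Λ l : ℕ} {m ρ θ : ℝ}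
    (H : Admissible (Fintype.card ι) s j h L Λ l m ρ θ) {M : Matrix ι ι ℝ}
    (hM : ∀ i l, |M i l| ≤ m) (b : ι) :
    pr (fun E : ι → ι → Bool => ∃ v : ι → ℝ, (∃ i, |v i| = 1) ∧ (∀ i, |v i| ≤ 1) ∧
        Rich univ v (ρ ^ (l + 1))⁻¹ (θ ^ l) ∧ ∀ i, i ≠ b → rowDot M i v (E i) = 0) ≤
      l * (Λ ^ (s * 3 ^ j) * 3 ^ Fintype.card ι /
          (((1000 / 999) ^ j * θ) ^ Fintype.card ι * θ ^ l) +
        Λ ^ (2 * (s * 3 ^ j)) * (1 / 2) ^ (Fintype.card ι - 1)) := by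
  have hρ0 : 0 < ρ := zero_lt_one.trans H.hρ
  have hsum : ∀ k ∈ range l, _ := fun k hk =>
    pr_exists_kernel_scale_le H (mem_range.1 hk) hM b
  have h1 := sum_le_card_nsmul _ _ _ hsum
  rw [card_range, nsmul_eq_mul] at h1
  refine le_trans (le_trans (pr_mono ?_) (pr_exists_le (range l) _)) h1
  rintro E ⟨v, ⟨i₀, hi₀⟩, hv1, hrich, hE⟩
  obtain ⟨k, hk, hk1, hk2⟩ : ∃ k < l, Rich univ v (ρ ^ (l + 1 - k))⁻¹ (θ ^ (l - k)) ∧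
      ¬ Rich univ v (ρ ^ (l + 1 - (k + 1)))⁻¹ (θ ^ (l - (k + 1))) := by
    by_contra! hcon
    have hall : ∀ k ≤ l, Rich univ v (ρ ^ (l + 1 - k))⁻¹ (θ ^ (l - k)) := by
      intro k
      induction k with
      | zero => exact fun _ => hrich
      | succ k ih => exact fun hkl => hcon k hkl (ih (by lia))
    have := (hall l le_rfl).lt_one
    simp at this
  set a := ρ ^ (l + 1 - k) with ha
  have ha0 : 0 < a := by positivity
  have haa : a * (ρ ^ (l + 1 - (k + 1)))⁻¹ = ρ := by
    rw [ha, show l + 1 - k = (l + 1 - (k + 1)) + 1 by lia, pow_succ]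
    field_simp
  have haw : ∀ i, |(a • v) i| = a * |v i| := fun i => by
    rw [Pi.smul_apply, smul_eq_mul, abs_mul, abs_of_pos ha0]
  refine ⟨k, mem_range.2 hk, a • v, ⟨fun i => ?_, ?_, fun hr => hk2 ?_, i₀, ?_⟩, fun i hi => ?_⟩
  · rw [haw]
    calc a * |v i| ≤ a * 1 := by gcongr; exact hv1 i
      _ = a := mul_one a
      _ ≤ ρ ^ (l + 1) := pow_le_pow_right₀ H.hρ.le (Nat.sub_le _ _)
      _ ≤ L := H.hρL
  · have := hk1.smul ha0
    rwa [mul_inv_cancel₀ ha0.ne'] at this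
  · have := hr.smul (inv_pos.2 ha0)
    rw [smul_smul, inv_mul_cancel₀ ha0.ne', one_smul, ← haa, inv_mul_cancel_left₀ ha0.ne'] at this
    exact this
  · rw [haw, hi₀, mul_one]
    calc ρ = ρ ^ 1 := (pow_one ρ).symm
      _ < a := pow_lt_pow_right₀ H.hρ (by lia)
  · rw [rowDot_smul, hE i hi, mul_zero]

end RichKernel

section Reduction

open Finset Classical

variable {ι : Type*} [Fintype ι]

lemma rowDot_eq_mulVec (M : Matrix ι ι ℝ) (E : ι → ι → Bool) (i : ι) (v : ι → ℝ) :
    rowDot M i v (E i) = ((M + Matrix.of fun i j => sgn (E i j)).mulVec v) i := by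
  simp [rowDot, signedSum, Matrix.mulVec, dotProduct, add_mul, sum_add_distrib]

/-- Deleting a row of a square matrix produces a normalized kernel vector. -/
lemma exists_kernel_vector (M : Matrix ι ι ℝ) (E : ι → ι → Bool) (b : ι) :
    ∃ v : ι → ℝ, (∃ i, |v i| = 1) ∧ (∀ i, |v i| ≤ 1) ∧
      ∀ i, i ≠ b → rowDot M i v (E i) = 0 := by
  set Y := (M + Matrix.of fun i j => sgn (E i j)).updateRow b 0 with hY
  have hdet : Y.det = 0 := Matrix.det_eq_zero_of_row_eq_zero b fun j => by simp [hY]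
  obtain ⟨v, hv0, hv⟩ := Matrix.exists_mulVec_eq_zero_iff.2 hdet
  obtain ⟨i₀, -, hi₀⟩ := exists_max_image univ (fun i => |v i|) ⟨b, mem_univ b⟩
  have hpos : 0 < |v i₀| := by
    obtain ⟨i, hi⟩ := Function.ne_iff.1 hv0
    exact (abs_pos.2 hi).trans_le (hi₀ i (mem_univ i))
  have habs : ∀ i, |(|v i₀|⁻¹ • v) i| = |v i₀|⁻¹ * |v i| := fun i => by
    rw [Pi.smul_apply, smul_eq_mul, abs_mul, abs_inv, abs_abs]
  refine ⟨|v i₀|⁻¹ • v, ⟨i₀, ?_⟩, fun i => ?_, fun i hi => ?_⟩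
  · rw [habs, inv_mul_cancel₀ hpos.ne']
  · rw [habs, inv_mul_le_one₀ hpos]
    exact hi₀ i (mem_univ i)
  · have h1 := congrFun hv i
    rw [rowDot_smul, rowDot_eq_mulVec]
    have h2 : (Y.mulVec v) i = ((M + Matrix.of fun i j => sgn (E i j)).mulVec v) i := by
      simp [hY, Matrix.mulVec, Matrix.updateRow_ne hi]
    rw [← h2, h1, Pi.zero_apply, mul_zero]

/-- A matrix is well invertible when it maps bounded vectors to large multiples of the
basis vectors. -/
lemma det_ne_zero_and_abs_inv_le {X : Matrix ι ι ℝ} {v : ι → ι → ℝ} {δ : ℝ} (hδ : 0 < δ)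
    (hv : ∀ b i, i ≠ b → (X.mulVec (v b)) i = 0) (hv1 : ∀ b i, |v b i| ≤ 1)
    (h : ∀ b, δ < |(X.mulVec (v b)) b|) : X.det ≠ 0 ∧ ∀ i b, |X⁻¹ i b| ≤ δ⁻¹ := by
  set t : ι → ℝ := fun b => (X.mulVec (v b)) b with ht
  have ht0 : ∀ b, t b ≠ 0 := fun b => abs_pos.1 (hδ.trans (h b))
  set Y : Matrix ι ι ℝ := Matrix.of fun i b => v b i / t b with hY
  have hXY : X * Y = 1 := by
    ext i b
    have h1 : (X * Y) i b = (X.mulVec (v b)) i / t b := by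
      simp only [Matrix.mul_apply, hY, Matrix.of_apply, Matrix.mulVec, dotProduct]
      rw [sum_div]
      exact sum_congr rfl fun _ _ => by ring
    rw [h1]
    by_cases hib : i = b
    · subst hib
      rw [Matrix.one_apply_eq]
      exact div_self (ht0 i)
    · rw [hv b i hib, zero_div, Matrix.one_apply_ne hib]
  refine ⟨fun h0 => ?_, fun i b => ?_⟩
  · have := congrArg Matrix.det hXY
    rw [Matrix.det_mul, h0, zero_mul, Matrix.det_one] at this
    exact zero_ne_one this
  · rw [Matrix.inv_eq_right_inv hXY, hY, Matrix.of_apply, abs_div, ← one_div]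
    exact div_le_div₀ zero_le_one (hv1 b i) hδ (h b).le

/-- The probability that the perturbed random matrix is singular or that its inverse has a large
entry. -/
lemma pr_ill_conditioned_le {s j h L Λ l : ℕ} {m ρ θ : ℝ}
    (H : Admissible (Fintype.card ι) s j h L Λ l m ρ θ) {M : Matrix ι ι ℝ}
    (hM : ∀ i l, |M i l| ≤ m) :
    pr (fun E : ι → ι → Bool => ¬ ((M + Matrix.of fun i j => sgn (E i j)).det ≠ 0 ∧
        ∀ i b, |(M + Matrix.of fun i j => sgn (E i j))⁻¹ i b| ≤ ρ ^ (l + 1))) ≤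
      Fintype.card ι * (θ ^ l + l * (Λ ^ (s * 3 ^ j) * 3 ^ Fintype.card ι /
          (((1000 / 999) ^ j * θ) ^ Fintype.card ι * θ ^ l) +
        Λ ^ (2 * (s * 3 ^ j)) * (1 / 2) ^ (Fintype.card ι - 1))) := by
  have hρ0 : 0 < ρ := zero_lt_one.trans H.hρ
  set δ := (ρ ^ (l + 1))⁻¹ with hδ
  have hδ0 : 0 < δ := by positivity
  choose f hf1 hf2 hf3 using exists_kernel_vector M
  set e₀ : ι → Bool := fun _ => true
  set v : (ι → ι → Bool) → ι → ι → ℝ := fun E b => f (Function.update E b e₀) b with hv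
  have hv3 : ∀ E b i, i ≠ b → rowDot M i (v E b) (E i) = 0 := fun E b i hi => by
    have := hf3 (Function.update E b e₀) b i hi
    rwa [Function.update_of_ne hi] at this
  refine (pr_mono (q := fun E => ∃ b ∈ (univ : Finset ι), |rowDot M b (v E b) (E b)| ≤ δ)
    fun E hE => ?_).trans ((pr_exists_le univ _).trans ?_)
  · by_contra! hcon
    refine hE ?_
    have := det_ne_zero_and_abs_inv_le (X := M + Matrix.of fun i j => sgn (E i j)) (v := v E) hδ0
      (fun b i hi => by rw [← rowDot_eq_mulVec]; exact hv3 E b i hi) (fun b i => hf2 _ b i)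
      (fun b => by rw [← rowDot_eq_mulVec]; exact hcon b (mem_univ b))
    rwa [hδ, inv_inv] at this
  rw [← nsmul_eq_mul, ← card_univ]
  refine sum_le_card_nsmul _ _ _ fun b _ => ?_
  refine (pr_mono (q := fun E => (¬ Rich univ (v E b) δ (θ ^ l) ∧ |rowDot M b (v E b) (E b)| ≤ δ) ∨
    ∃ w : ι → ℝ, (∃ i, |w i| = 1) ∧ (∀ i, |w i| ≤ 1) ∧ Rich univ w δ (θ ^ l) ∧
      ∀ i, i ≠ b → rowDot M i w (E i) = 0) fun E hE => ?_).trans ((pr_or_le _ _).trans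
        (add_le_add ?_ (pr_exists_rich_kernel_le H hM b)))
  · by_cases hr : Rich univ (v E b) δ (θ ^ l)
    · exact Or.inr ⟨v E b, hf1 _ b, hf2 _ b, hr, hv3 E b⟩
    · exact Or.inl ⟨hr, hE⟩
  · refine pr_update_le b _ fun E => ?_
    have hvE : ∀ ε, v (Function.update E b ε) b = v E b := fun ε => by
      simp only [hv, Function.update_idem]
    simp only [hvE, Function.update_self]
    by_cases hr : Rich univ (v E b) δ (θ ^ l)
    · refine le_trans (le_of_eq ?_) (pow_nonneg H.hθ.le l)
      simp [pr, hr]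
    · refine (pr_mono fun ε hε => ?_).trans (not_rich_iff.1 hr (-∑ l, M b l * v E b l))
      rw [sub_neg_eq_add, add_comm]
      exact hε.2

lemma pr_fun_bool (p : (ι → ι → Bool) → Prop) :
    pr p = Nat.card {E // p E} / 2 ^ (Fintype.card ι * Fintype.card ι) := by
  rw [pr_eq_card, Nat.card_eq_fintype_card, Fintype.card_subtype]
  simp [← pow_mul]

/-- A counting version of `pr_ill_conditioned_le`. -/
lemma card_le_of_ill_conditioned [inst : DecidableEq ι] {s j h L Λ l : ℕ} {m ρ θ : ℝ}
    (H : Admissible (Fintype.card ι) s j h L Λ l m ρ θ) {M : Matrix ι ι ℝ}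
    (hM : ∀ i l, |M i l| ≤ m) (Q : (ι → ι → Bool) → Prop)
    (hQ : ∀ E, Q E → ¬ ((M + Matrix.of fun i j => sgn (E i j)).det ≠ 0 ∧
        ∀ i b, |(M + Matrix.of fun i j => sgn (E i j))⁻¹ i b| ≤ ρ ^ (l + 1))) :
    (Nat.card {E // Q E} : ℝ) / 2 ^ (Fintype.card ι * Fintype.card ι) ≤
      Fintype.card ι * (θ ^ l + l * (Λ ^ (s * 3 ^ j) * 3 ^ Fintype.card ι /
          (((1000 / 999) ^ j * θ) ^ Fintype.card ι * θ ^ l) +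
        Λ ^ (2 * (s * 3 ^ j)) * (1 / 2) ^ (Fintype.card ι - 1))) := by
  obtain rfl : inst = fun a b => propDecidable (a = b) := Subsingleton.elim _ _
  rw [← pr_fun_bool]
  exact (pr_mono hQ).trans (pr_ill_conditioned_le H hM)

end Reduction
section SpectralNorm

open Finset

variable {n : ℕ}

lemma toEuclideanLin_apply_apply (M : Matrix (Fin n) (Fin n) ℝ) (x : EuclideanSpace ℝ (Fin n))
    (i : Fin n) : Matrix.toEuclideanLin M x i = ∑ j, M i j * x j := rfl

lemma abs_apply_le_specNorm (M : Matrix (Fin n) (Fin n) ℝ) (i j : Fin n) :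
    |M i j| ≤ specNorm M := by
  have h1 := (LinearMap.toContinuousLinearMap (Matrix.toEuclideanLin M)).le_opNorm
    (EuclideanSpace.single j (1 : ℝ))
  rw [PiLp.norm_single, norm_one, mul_one] at h1
  refine le_trans ?_ h1
  have h2 : LinearMap.toContinuousLinearMap (Matrix.toEuclideanLin M)
      (EuclideanSpace.single j (1 : ℝ)) i = M i j := by
    rw [LinearMap.coe_toContinuousLinearMap', toEuclideanLin_apply_apply]
    simp
  rw [← h2]
  exact PiLp.norm_apply_le (LinearMap.toContinuousLinearMap (Matrix.toEuclideanLin M)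
    (EuclideanSpace.single j (1 : ℝ))) i

lemma specNorm_le {M : Matrix (Fin n) (Fin n) ℝ} {c : ℝ} (hc : 0 ≤ c)
    (hM : ∀ i j, |M i j| ≤ c) : specNorm M ≤ n * c := by
  refine ContinuousLinearMap.opNorm_le_bound _ (by positivity) fun x => ?_
  rw [LinearMap.coe_toContinuousLinearMap']
  refine le_of_sq_le_sq ?_ (by positivity)
  rw [mul_pow, EuclideanSpace.real_norm_sq_eq, EuclideanSpace.real_norm_sq_eq]
  have h1 : ∀ i, ∑ j, M i j ^ 2 ≤ n * c ^ 2 := fun i => by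
    refine (sum_le_card_nsmul univ _ (c ^ 2) fun j _ => ?_).trans (by simp)
    rw [← sq_abs]
    exact pow_le_pow_left₀ (abs_nonneg _) (hM i j) 2
  refine (sum_le_card_nsmul univ _ (n * c ^ 2 * ∑ j, x j ^ 2) fun i _ => ?_).trans
    (le_of_eq ?_)
  · rw [toEuclideanLin_apply_apply]
    exact (sum_mul_sq_le_sq_mul_sq univ (M i) x).trans (by gcongr; exact h1 i)
  · rw [card_univ, Fintype.card_fin, nsmul_eq_mul]
    ring

lemma card_ill_conditioned_le {s j h L Λ l : ℕ} {m ρ θ K : ℝ}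
    (H : Admissible n s j h L Λ l m ρ θ) {M : Matrix (Fin n) (Fin n) ℝ} (hM : specNorm M ≤ m)
    (hK : n * (m + 1) * (n * ρ ^ (l + 1)) < K) :
    (Nat.card {E : Fin n → Fin n → Bool //
        (M + Matrix.of fun i j => if E i j then (1 : ℝ) else -1).det = 0 ∨
        K ≤ specNorm (M + Matrix.of fun i j => if E i j then (1 : ℝ) else -1) *
            specNorm (M + Matrix.of fun i j => if E i j then (1 : ℝ) else -1)⁻¹} : ℝ) /
        2 ^ (n * n) ≤
      n * (θ ^ l + l * (Λ ^ (s * 3 ^ j) * 3 ^ n / (((1000 / 999) ^ j * θ) ^ n * θ ^ l) +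
        Λ ^ (2 * (s * 3 ^ j)) * (1 / 2) ^ (n - 1))) := by
  have hent : ∀ i j, |M i j| ≤ m := fun i j => (abs_apply_le_specNorm M i j).trans hM
  have hm : 0 ≤ m := (norm_nonneg _).trans hM
  have hρ0 : 0 < ρ := zero_lt_one.trans H.hρ
  have H' : Admissible (Fintype.card (Fin n)) s j h L Λ l m ρ θ := by rwa [Fintype.card_fin]
  have h1 := card_le_of_ill_conditioned H' hent (fun E =>
      (M + Matrix.of fun i j => if E i j then (1 : ℝ) else -1).det = 0 ∨
        K ≤ specNorm (M + Matrix.of fun i j => if E i j then (1 : ℝ) else -1) *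
            specNorm (M + Matrix.of fun i j => if E i j then (1 : ℝ) else -1)⁻¹) fun E hE => ?_
  · rwa [Fintype.card_fin] at h1
  · rintro ⟨hdet, hinv⟩
    have hsgn : (Matrix.of fun i j => sgn (E i j)) =
        Matrix.of fun i j => if E i j then (1 : ℝ) else -1 := rfl
    rw [← hsgn] at hE
    refine hE.elim hdet fun hK' => ?_
    refine absurd (hK'.trans (mul_le_mul (specNorm_le (by positivity) fun i j => ?_)
      (specNorm_le (by positivity) hinv) (norm_nonneg _) (by positivity))) (not_le.2 hK)
    rw [Matrix.add_apply, Matrix.of_apply]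
    exact (abs_add_le _ _).trans (add_le_add (hent i j) (abs_sgn _).le)

end SpectralNorm

section Asymptotics

open Filter Real

lemma eventually_mul_pow_le_exp (K : ℝ) (k : ℕ) {b : ℝ} (hb : 0 < b) :
    ∀ᶠ x : ℝ in atTop, K * x ^ k ≤ exp (b * x) := by
  have h1 := ((isLittleO_pow_exp_pos_mul_atTop hb (k := k)).const_mul_left K).bound one_pos
  filter_upwards [h1] with x hx
  rw [one_mul, norm_of_nonneg (exp_pos _).le] at hx
  exact (le_abs_self _).trans hx

lemma three_pow_le_exp (k : ℕ) : (3 : ℝ) ^ k ≤ exp (2 * k) := by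
  rw [mul_comm, exp_nat_mul]
  exact pow_le_pow_left₀ (by norm_num) (by linarith [add_one_le_exp (2 : ℝ)]) k

lemma half_pow_le_exp (k : ℕ) : (1 / 2 : ℝ) ^ k ≤ exp (-(k / 2)) := by
  rw [show -((k : ℝ) / 2) = k * (-1 / 2) by ring, exp_nat_mul]
  exact pow_le_pow_left₀ (by norm_num) (by linarith [add_one_le_exp (-1 / 2 : ℝ)]) k

lemma exp_le_two_pow (k : ℕ) : exp (k / 2) ≤ (2 : ℝ) ^ k := by
  have h1 := half_pow_le_exp k
  rw [exp_neg, one_div, inv_pow] at h1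
  exact (inv_le_inv₀ (by positivity) (exp_pos _)).1 h1

lemma exp_le_pow (k : ℕ) : exp (k / 1000) ≤ (1000 / 999 : ℝ) ^ k := by
  rw [show (k : ℝ) / 1000 = k * (1 / 1000) by ring, exp_nat_mul]
  refine pow_le_pow_left₀ (exp_pos _).le ?_ k
  have h1 := add_one_le_exp (-(1 / 1000) : ℝ)
  rw [exp_neg] at h1
  have h2 : (exp (1 / 1000 : ℝ)) ≤ (999 / 1000)⁻¹ := by
    rw [le_inv_comm₀ (exp_pos _) (by norm_num)]
    linarith
  linarith [show ((999 : ℝ) / 1000)⁻¹ = 1000 / 999 by norm_num]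

/-- The size of the covers is negligible compared to exponentials in the dimension. -/
lemma eventually_exp_sqrt_le (D a : ℝ) (hD : 0 ≤ D) (ha : 0 ≤ a) {η : ℝ} (hη : 0 < η) :
    ∀ᶠ x : ℝ in atTop, exp (x / 2 + 3) * (D * x) + a * x + 2 * exp x ≤ exp x * (η * x) ∧
      2 * exp (x / 2 + 3) * (D * x) + a * x ≤ (exp x - 1) / 2 := by
  filter_upwards [eventually_mul_pow_le_exp (8 * (exp 3 * D + a)) 1 (b := 1 / 2) (by norm_num),
    eventually_ge_atTop (3 / η), eventually_ge_atTop 4] with x h1 h2 h3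
  have h4 : 3 ≤ η * x := by rwa [div_le_iff₀' hη] at h2
  have h5 : exp x = exp (1 / 2 * x) * exp (1 / 2 * x) := by
    rw [← exp_add]; congr 1; ring
  have h6 : exp (x / 2 + 3) = exp 3 * exp (1 / 2 * x) := by
    rw [← exp_add]; congr 1; ring
  have h7 : 3 ≤ exp (1 / 2 * x) := by linarith [add_one_le_exp (1 / 2 * x)]
  rw [h5, h6]
  rw [pow_one] at h1
  set y := exp (1 / 2 * x)
  have h8 : 8 * (exp 3 * D + a) * x * y ≤ y * y := by gcongr
  have h9 : a * x ≤ a * x * y := le_mul_of_one_le_right (by positivity) (by linarith)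
  have h10 : 0 ≤ exp 3 * D * x * y := by positivity
  have h11 : y * y * 3 ≤ y * y * (η * x) := by gcongr
  have h12 : 0 ≤ a * x * y := by positivity
  constructor <;> nlinarith

set_option maxHeartbeats 1000000 in
/-- The parameters of the covering argument can be chosen for all large dimensions. -/
lemma eventually_exists_admissible {C : ℝ} (hC : 0 < C) (a : ℝ) (ha : 0 ≤ a) (l : ℕ) :
    ∀ᶠ n : ℕ in atTop, ∃ s j h L Λ : ℕ,
      Admissible n s j h L Λ l ((n : ℝ) ^ C) ((n : ℝ) ^ (C + 5)) ((n : ℝ) ^ (-(1 / 16000) : ℝ)) ∧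
      (Λ : ℝ) ^ (s * 3 ^ j) * 3 ^ n /
        (((1000 / 999) ^ j * (n : ℝ) ^ (-(1 / 16000) : ℝ)) ^ n *
          ((n : ℝ) ^ (-(1 / 16000) : ℝ)) ^ l) ≤ (n : ℝ) ^ (-a) ∧
      (Λ : ℝ) ^ (2 * (s * 3 ^ j)) * (1 / 2) ^ (n - 1) ≤ (n : ℝ) ^ (-a) := by
  set q : ℝ := l / 16000 with hq
  have hq0 : 0 ≤ q := by positivity
  set D : ℝ := 2 + (C + 5) * (l + 1) with hD
  have hD0 : 0 ≤ D := by positivity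
  have hlog : Tendsto (fun n : ℕ => log n) atTop atTop :=
    tendsto_log_atTop.comp tendsto_natCast_atTop_atTop
  filter_upwards [eventually_ge_atTop 100, hlog.eventually (eventually_ge_atTop 1),
    hlog.eventually (eventually_exp_sqrt_le D (a + q) hD0 (by positivity)
      (η := 1 / 16000) (by norm_num)),
    hlog.eventually (eventually_mul_pow_le_exp (2 * (6 + (2 * (1 + q) + 2) * D)) 2 (b := 1 / 4)
      (by norm_num)),
    hlog.eventually (eventually_mul_pow_le_exp (2 * (1 + q)) 1 (b := 1 / 4) (by norm_num)),
    hlog.eventually (eventually_mul_pow_le_exp 100 1 (b := 1 / 4) (by norm_num))]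
    with n hn hx1 ⟨hcov1, hcov2⟩ hpow hh hs
  have hn' : (100 : ℝ) ≤ n := by exact_mod_cast hn
  have hn0 : (0 : ℝ) < n := by linarith
  set x := log n with hx
  have hnx : (n : ℝ) = exp x := (exp_log hn0).symm
  have hrpow : ∀ t : ℝ, (n : ℝ) ^ t = exp (t * x) := fun t => by
    rw [rpow_def_of_pos hn0, mul_comm]
  rw [pow_one] at hh hs
  set θ := (n : ℝ) ^ (-(1 / 16000) : ℝ) with hθ
  have hθl : θ ^ l = exp (-(q * x)) := by
    rw [hθ, hrpow, ← exp_nat_mul]; congr 1; rw [hq]; ring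
  set ρ := (n : ℝ) ^ (C + 5) with hρ
  have hρ1 : 1 < ρ := one_lt_rpow (by linarith) (by linarith)
  have hρl : ρ ^ (l + 1) = exp ((C + 5) * (l + 1) * x) := by
    rw [hρ, hrpow, ← exp_nat_mul]; congr 1; push_cast; ring
  set s := ⌈exp (1 / 4 * x)⌉₊ with hsdef
  set j := ⌈x / 8⌉₊ with hjdef
  set h := ⌈2 * (1 + q) * x⌉₊ with hhdef
  set L := ⌈ρ ^ (l + 1)⌉₊ with hLdef
  obtain ⟨Λ, hΛ⟩ : ∃ Λ, Λ = 2 * (n * L + L + 1) + 1 := ⟨_, rfl⟩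
  have hL1 : 1 ≤ L := Nat.one_le_ceil_iff.2 (by positivity)
  have hsl : exp (1 / 4 * x) ≤ s := Nat.le_ceil _
  have hsu : (s : ℝ) ≤ exp (x / 4 + 1) := by
    have h1 := (Nat.ceil_lt_add_one (exp_pos (1 / 4 * x)).le).le
    rw [exp_add, show x / 4 = 1 / 4 * x by ring]
    have h2 : 1 ≤ exp (1 / 4 * x) := one_le_exp (by linarith)
    have h3 : exp (1 / 4 * x) * 2 ≤ exp (1 / 4 * x) * exp 1 := by
      gcongr
      linarith [add_one_le_exp (1 : ℝ)]
    linarith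
  have hjl : x / 8 ≤ j := Nat.le_ceil _
  have hju : (j : ℝ) ≤ x / 8 + 1 := (Nat.ceil_lt_add_one (by linarith)).le
  have hhl : 2 * (1 + q) * x ≤ h := Nat.le_ceil _
  have hhu : (h : ℝ) ≤ 2 * (1 + q) * x + 1 := (Nat.ceil_lt_add_one (by positivity)).le
  have hΛ0 : (1 : ℝ) ≤ Λ := by rw [hΛ]; exact_mod_cast Nat.le_add_left _ _
  have hΛD : (Λ : ℝ) ≤ exp (D * x) := by
    have h1 : (L : ℝ) ≤ 2 * ρ ^ (l + 1) := by
      have := (Nat.ceil_lt_add_one (by positivity : 0 ≤ ρ ^ (l + 1))).le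
      linarith [one_le_pow₀ hρ1.le (n := l + 1)]
    have h2 : exp (D * x) = n * n * ρ ^ (l + 1) := by
      rw [hρl, hnx, ← exp_add, ← exp_add]; congr 1; rw [hD]; ring
    have h3 : (1 : ℝ) ≤ L := by exact_mod_cast hL1
    rw [h2, hΛ]
    push_cast
    have h4 : (n : ℝ) * L ≤ n * (2 * ρ ^ (l + 1)) := by gcongr
    have h5 : 100 * L ≤ (n : ℝ) * L := by gcongr
    have h6 : 100 * (n * ρ ^ (l + 1)) ≤ (n : ℝ) * (n * ρ ^ (l + 1)) := by gcongr
    linarith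
  have hΛpow : ∀ k : ℕ, (Λ : ℝ) ^ k ≤ exp (k * (D * x)) := fun k => by
    rw [exp_nat_mul]
    gcongr
  have hτ : ((s * 3 ^ j : ℕ) : ℝ) ≤ exp (x / 2 + 3) := by
    push_cast
    calc (s : ℝ) * 3 ^ j ≤ exp (x / 4 + 1) * exp (2 * j) := by
          gcongr
          exact three_pow_le_exp j
      _ ≤ exp (x / 4 + 1) * exp (x / 4 + 2) := by gcongr; linarith
      _ = _ := by rw [← exp_add]; congr 1; ring
  have hDx : 0 ≤ D * x := by positivity
  have hhs : h ≤ s := Nat.ceil_mono hh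
  have hLρ : ρ ^ (l + 1) ≤ L := Nat.le_ceil _
  have hθ0 : 0 < θ := rpow_pos_of_pos hn0 _
  clear_value s j h L x θ ρ D
  refine ⟨s, j, h, L, Λ, ⟨by lia, ?_, hhs, hL1, hΛ, ?_, hθ0, ?_, ?_, hρ1,
    hLρ, ?_⟩, ?_, ?_⟩
  · have : (100 : ℝ) ≤ s := by linarith
    exact_mod_cast this
  · have h1 : (3 : ℝ) ^ j * (2 * Λ ^ (h + 1)) ≤ 2 ^ s := by
      calc (3 : ℝ) ^ j * (2 * Λ ^ (h + 1)) ≤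
          exp (2 * j) * (exp 1 * exp ((h + 1 : ℕ) * (D * x))) := by
            gcongr
            · exact three_pow_le_exp j
            · linarith [add_one_le_exp (1 : ℝ)]
            · exact hΛpow _
        _ = exp (2 * j + (1 + (h + 1 : ℕ) * (D * x))) := by rw [exp_add, exp_add]
        _ ≤ exp (s / 2) := by
            gcongr
            have h2 : ((h + 1 : ℕ) : ℝ) * (D * x) ≤ (2 * (1 + q) * x + 2) * (D * x) := by
              gcongr
              push_cast
              linarith
            have h3 : (2 * (1 + q) * x + 2) * (D * x) ≤ ((2 * (1 + q) + 2) * x) * (D * x) := by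
              gcongr
              linarith
            have h4 : (6 + (2 * (1 + q) + 2) * D) * x ^ 2 ≤ s / 2 := by linarith
            have h5 : x ≤ x ^ 2 := le_self_pow₀ hx1 two_ne_zero
            linarith
        _ ≤ _ := exp_le_two_pow s
    exact_mod_cast h1
  · rw [hθ]
    exact rpow_le_one_of_one_le_of_nonpos (by linarith) (by norm_num)
  · rw [hθl]
    calc (n : ℝ) * (1 / 2) ^ h ≤ exp x * exp (-(h / 2)) := by
          rw [← hnx]
          gcongr
          exact half_pow_le_exp h
      _ ≤ _ := by
          rw [← exp_add]
          gcongr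
          linarith
  · have h1 : ρ = (n : ℝ) ^ C * (n : ℝ) ^ 5 := by
      rw [hρ, rpow_add hn0]
      norm_cast
    have h2 : (1 : ℝ) ≤ (n : ℝ) ^ C := one_le_rpow (by linarith) hC.le
    rw [h1]
    set u := (n : ℝ) ^ C
    have h3 : ((n : ℝ) + 1) ^ 2 ≤ 4 * n ^ 2 := by
      rw [show (4 : ℝ) * n ^ 2 = (n + n) ^ 2 by ring]
      gcongr
      linarith
    calc n * (u + 1) * (4 * ((n : ℝ) + 1) ^ 2) + n * (4 * ((n : ℝ) + 1) ^ 2)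
        ≤ n * (u + u) * (4 * (4 * n ^ 2)) + n * u * (4 * (4 * n ^ 2)) := by
          gcongr
          exact le_mul_of_one_le_right hn0.le h2
      _ = u * n ^ 3 * 48 := by ring
      _ ≤ u * n ^ 3 * (n ^ 2) := by
          gcongr
          exact (by norm_num : (48 : ℝ) ≤ 100 ^ 2).trans (by gcongr)
      _ = _ := by ring
  · rw [hθl, hrpow, div_le_iff₀ (by positivity)]
    have h1 : exp (1 / 16000 * x * n) ≤ ((1000 / 999) ^ j * θ) ^ n := by
      rw [mul_comm, exp_nat_mul]
      gcongr
      rw [hθ, hrpow]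
      calc exp (1 / 16000 * x) ≤ exp (j / 1000) * exp (-(1 / 16000) * x) := by
            rw [← exp_add]
            gcongr
            linarith
        _ ≤ _ := by
            gcongr
            exact exp_le_pow j
    calc (Λ : ℝ) ^ (s * 3 ^ j) * 3 ^ n ≤ exp (exp (x / 2 + 3) * (D * x)) * exp (2 * n) := by
          gcongr
          · refine (hΛpow _).trans ?_
            gcongr
          · exact three_pow_le_exp n
      _ ≤ exp (-a * x) * (exp (1 / 16000 * x * n) * exp (-(q * x))) := by
          rw [← exp_add, ← exp_add, ← exp_add]
          refine exp_le_exp.2 ?_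
          rw [hnx]
          linarith
      _ ≤ _ := by gcongr
  · rw [hrpow]
    calc (Λ : ℝ) ^ (2 * (s * 3 ^ j)) * (1 / 2) ^ (n - 1) ≤
        exp (2 * exp (x / 2 + 3) * (D * x)) * exp (-((n - 1 : ℕ) / 2)) := by
          gcongr
          · refine (hΛpow _).trans ?_
            gcongr
            rw [Nat.cast_mul, Nat.cast_two]
            gcongr
          · exact half_pow_le_exp _
      _ ≤ _ := by
          rw [← exp_add]
          refine exp_le_exp.2 ?_
          rw [Nat.cast_sub (by lia), hnx, Nat.cast_one]
          have h1 : 0 ≤ q * x := by positivity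
          linarith

end Asymptotics

/-- **Tao–Vu condition number theorem for perturbed matrices.** Let `Mₙ` be the `n × n`
random matrix with i.i.d. uniform `±1` entries (modeled by a uniform
`s : Fin n → Fin n → Bool`).  For all `A, C > 0` there is `B > 0` such that for all
sufficiently large `n` and every deterministic `n × n` real matrix `M` with
`‖M‖ ≤ n ^ C`, the probability that `M + Mₙ` is singular or its condition number
`‖M + Mₙ‖ · ‖(M + Mₙ)⁻¹‖` is at least `n ^ B` is at most `n ^ (-A)`. -/
theorem condition_number_perturbed (A C : ℝ) (hA : 0 < A) (hC : 0 < C) :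
    ∃ B : ℝ, 0 < B ∧ ∃ N : ℕ, ∀ n : ℕ, N ≤ n →
      ∀ M : Matrix (Fin n) (Fin n) ℝ, specNorm M ≤ (n : ℝ) ^ C →
        (Nat.card {s : Fin n → Fin n → Bool //
            (M + Matrix.of fun i j => if s i j then (1 : ℝ) else -1).det = 0 ∨
            (n : ℝ) ^ B ≤
              specNorm (M + Matrix.of fun i j => if s i j then (1 : ℝ) else -1) *
                specNorm (M + Matrix.of fun i j => if s i j then (1 : ℝ) else -1)⁻¹} : ℝ)
          / 2 ^ (n * n) ≤ (n : ℝ) ^ (-A) := by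
  set l := ⌈16000 * (A + 2)⌉₊ with hl
  have hlA : 16000 * (A + 2) ≤ l := Nat.le_ceil _
  have hev := ((eventually_exists_admissible hC (A + 3) (by positivity) l).and
    (Filter.eventually_ge_atTop (2 * l + 3))).exists_forall_of_atTop
  obtain ⟨N, hN⟩ := hev
  refine ⟨(C + 5) * (l + 1) + C + 5, by positivity, N, fun n hn M hM => ?_⟩
  obtain ⟨⟨s, j, h, L, Λ, H, hb1, hb2⟩, hnl⟩ := hN n hn
  have hnl' : (2 * l + 3 : ℝ) ≤ n := by exact_mod_cast hnl
  have hn3 : (3 : ℝ) ≤ n := by linarith [(Nat.cast_nonneg l : (0 : ℝ) ≤ l)]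
  have hn0 : (0 : ℝ) < n := by linarith
  have hC1 : (1 : ℝ) ≤ (n : ℝ) ^ C := Real.one_le_rpow (by linarith) hC.le
  refine (card_ill_conditioned_le H hM ?_).trans ?_
  · have h1 : (n : ℝ) ^ ((C + 5) * (l + 1) + C + 5) =
        ((n : ℝ) ^ (C + 5)) ^ (l + 1) * (n : ℝ) ^ C * (n : ℝ) ^ 5 := by
      rw [Real.rpow_add hn0, Real.rpow_add hn0, ← Real.rpow_natCast (_ ^ _), ← Real.rpow_mul hn0.le]
      norm_cast
    rw [h1]
    set u := (n : ℝ) ^ C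
    have h2 : 0 < ((n : ℝ) ^ (C + 5)) ^ (l + 1) := by positivity
    set r := ((n : ℝ) ^ (C + 5)) ^ (l + 1)
    calc n * (u + 1) * (n * r) ≤ n * (u + u) * (n * r) := by gcongr
      _ = r * u * n ^ 2 * 2 := by ring
      _ < r * u * n ^ 2 * n ^ 3 := by
          gcongr
          calc (2 : ℝ) < 3 ^ 3 := by norm_num
            _ ≤ _ := by gcongr
      _ = _ := by ring
  · have hθ : ((n : ℝ) ^ (-(1 / 16000) : ℝ)) ^ l ≤ (n : ℝ) ^ (-(A + 2)) := by
      rw [← Real.rpow_natCast, ← Real.rpow_mul hn0.le]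
      exact Real.rpow_le_rpow_of_exponent_le (by linarith) (by linarith)
    have h2 : (n : ℝ) ^ (-(A + 2)) = (n : ℝ) ^ (-A) / n ^ 2 := by
      rw [neg_add, Real.rpow_add hn0, Real.rpow_neg hn0.le 2, div_eq_mul_inv]
      norm_cast
    have h3 : (n : ℝ) ^ (-(A + 3)) = (n : ℝ) ^ (-A) / n ^ 3 := by
      rw [neg_add, Real.rpow_add hn0, Real.rpow_neg hn0.le 3, div_eq_mul_inv]
      norm_cast
    rw [h2] at hθ
    rw [h3] at hb1 hb2
    refine (mul_le_mul_of_nonneg_left (add_le_add hθ (mul_le_mul_of_nonneg_left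
      (add_le_add hb1 hb2) (Nat.cast_nonneg l))) hn0.le).trans ?_
    have hu : 0 < (n : ℝ) ^ (-A) := by positivity
    set u := (n : ℝ) ^ (-A)
    have h4 : n * (u / n ^ 2 + l * (u / n ^ 3 + u / n ^ 3)) = u * ((n + 2 * l) / n ^ 2) := by
      field_simp
      ring
    rw [h4]
    refine mul_le_of_le_one_right hu.le ?_
    rw [div_le_one (by positivity)]
    nlinarith
end

section
/- Let $d \geq 2$ and $k \geq 1$ be integers, and let $G$ be a finite $d$-regular graph that contains two edges $e_1, e_2$ such that the graph distance between $e_1$ and $e_2$ (the minimum over endpoints $u$ of $e_1$ and $v$ of $e_2$ of the distance between $u$ and $v$ in $G$) is at least $2k + 2$. Then the second largest eigenvalue $\lambda_2$ of the adjacency matrix of $G$ satisfies $\lambda_2 \geq 2\sqrt{d-1} - \frac{2\sqrt{d-1}}{k+1}$. -/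
open Polynomial

open scoped InnerProductSpace in
/-- A symmetric operator whose quadratic form is at least `c` on two nonzero vectors that are
orthogonal for both the inner product and the quadratic form has second largest eigenvalue at
least `c`. -/
theorem LinearMap.IsSymmetric.le_eigenvalues_one {E : Type*} [NormedAddCommGroup E]
    [InnerProductSpace ℝ E] [FiniteDimensional ℝ E] {T : E →ₗ[ℝ] E} (hT : T.IsSymmetric)
    {n : ℕ} (hn : Module.finrank ℝ E = n) {x y : E} {c : ℝ} (hx : x ≠ 0) (hy : y ≠ 0)
    (hxy : ⟪x, y⟫_ℝ = 0) (hTxy : ⟪T x, y⟫_ℝ = 0)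
    (hcx : c * ⟪x, x⟫_ℝ ≤ ⟪T x, x⟫_ℝ) (hcy : c * ⟪y, y⟫_ℝ ≤ ⟪T y, y⟫_ℝ)
    (i : Fin n) (hi : (i : ℕ) = 1) : c ≤ hT.eigenvalues hn i := by
  set b := hT.eigenvectorBasis hn
  let i₀ : Fin n := ⟨0, by omega⟩
  have hx' : 0 < ⟪x, x⟫_ℝ := real_inner_self_pos.2 hx
  have hy' : 0 < ⟪y, y⟫_ℝ := real_inner_self_pos.2 hy
  obtain ⟨s, t, hst, h₀⟩ : ∃ s t : ℝ, 0 < s ^ 2 + t ^ 2 ∧ ⟪b i₀, s • x + t • y⟫_ℝ = 0 := by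
    by_cases h : ⟪b i₀, x⟫_ℝ = 0
    · exact ⟨1, 0, by norm_num, by simp [h]⟩
    · refine ⟨⟪b i₀, y⟫_ℝ, -⟪b i₀, x⟫_ℝ,
        add_pos_of_nonneg_of_pos (sq_nonneg _) (sq_pos_of_ne_zero (neg_ne_zero.2 h)), ?_⟩
      rw [inner_add_right, inner_smul_right, inner_smul_right]
      ring
  set z := s • x + t • y with hz
  have hyx : ⟪y, x⟫_ℝ = 0 := by rw [real_inner_comm, hxy]
  have hTyx : ⟪T y, x⟫_ℝ = 0 := by rw [hT, real_inner_comm, hTxy]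
  have hzz : ⟪z, z⟫_ℝ = s ^ 2 * ⟪x, x⟫_ℝ + t ^ 2 * ⟪y, y⟫_ℝ := by
    simp only [hz, inner_add_left, inner_add_right, real_inner_smul_left, real_inner_smul_right,
      hxy, hyx]
    ring
  have hTzz : ⟪T z, z⟫_ℝ = s ^ 2 * ⟪T x, x⟫_ℝ + t ^ 2 * ⟪T y, y⟫_ℝ := by
    simp only [hz, map_add, map_smul, inner_add_left, inner_add_right, real_inner_smul_left,
      real_inner_smul_right, hTxy, hTyx]
    ring
  have hlow : c * ⟪z, z⟫_ℝ ≤ ⟪T z, z⟫_ℝ := by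
    rw [hzz, hTzz]
    nlinarith [mul_le_mul_of_nonneg_left hcx (sq_nonneg s),
      mul_le_mul_of_nonneg_left hcy (sq_nonneg t)]
  have hpos : 0 < ⟪z, z⟫_ℝ := by
    rw [hzz]
    rcases (sq_nonneg s).eq_or_lt with h | h
    · have : 0 < t ^ 2 := by linarith
      positivity
    · positivity
  have hup : ⟪T z, z⟫_ℝ ≤ hT.eigenvalues hn i * ⟪z, z⟫_ℝ := by
    rw [← b.sum_inner_mul_inner (T z) z, ← b.sum_inner_mul_inner z z, Finset.mul_sum]
    refine Finset.sum_le_sum fun j _ => ?_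
    have hj : ⟪T z, b j⟫_ℝ = hT.eigenvalues hn j * ⟪z, b j⟫_ℝ := by
      rw [hT, hT.apply_eigenvectorBasis hn j]
      simp [b, real_inner_smul_right]
    rw [hj, real_inner_comm (b j) z, mul_assoc]
    by_cases hj0 : j = i₀
    · rw [hj0, h₀]
      simp
    · have hij : i ≤ j := by
        have : (j : ℕ) ≠ 0 := fun h => hj0 (Fin.ext h)
        exact Fin.le_def.2 (by omega)
      exact mul_le_mul_of_nonneg_right (hT.eigenvalues_antitone hn hij) (mul_self_nonneg _)
  exact le_of_mul_le_mul_right (hlow.trans hup) hpos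

/-- An antitone list of the roots of the characteristic polynomial of a real symmetric matrix is
its list of eigenvalues. -/
theorem Matrix.IsHermitian.eq_eigenvalues₀_of_charpoly_eq {n : Type*} [Fintype n] [DecidableEq n]
    {A : Matrix n n ℝ} (hA : A.IsHermitian) {lam : Fin (Fintype.card n) → ℝ} (hanti : Antitone lam)
    (hchar : A.charpoly = ∏ i, (X - C (lam i))) : lam = hA.eigenvalues₀ := by
  have hroots : A.charpoly.roots = Multiset.map lam Finset.univ.val := by
    rw [hchar, Polynomial.roots_prod _ _
      (Finset.prod_ne_zero_iff.2 fun i _ => Polynomial.X_sub_C_ne_zero _)]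
    simp
  rw [hA.roots_charpoly_eq_eigenvalues₀, Fin.univ_val_map, Fin.univ_val_map,
    Multiset.coe_eq_coe] at hroots
  refine (List.ofFn_injective (hroots.eq_of_pairwise' (r := (· ≥ ·)) ?_ ?_)).symm
  · exact List.sortedGE_iff_pairwise.1 hA.eigenvalues₀_antitone.sortedGE_ofFn
  · exact List.sortedGE_iff_pairwise.1 hanti.sortedGE_ofFn

namespace SimpleGraph

variable {V : Type*} (G : SimpleGraph V)

/-- The test function decaying geometrically with ratio `r` along the levels of `h` up to level
`k`, and vanishing beyond. -/
noncomputable def levelDecay (h : V → ℕ) (k : ℕ) (r : ℝ) (u : V) : ℝ :=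
  if h u ≤ k then r ^ h u else 0

/-- A height function that changes by at most one along edges and such that every vertex of height
at most `k` has a neighbor one level lower, or on the same level if it has height zero. -/
structure IsHeight (h : V → ℕ) (k : ℕ) : Prop where
  le_add_one : ∀ ⦃u v⦄, G.Adj u v → h v ≤ h u + 1
  exists_adj : ∀ u, h u ≤ k → ∃ v, G.Adj u v ∧ h v = h u - 1

section Finite

variable {G} [Fintype V] [DecidableRel G.Adj] {d k : ℕ} {h : V → ℕ}

theorem IsHeight.card_upper_neighbors_le (hh : G.IsHeight h k) (hreg : G.IsRegularOfDegree d)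
    {u : V} (hu : h u ≤ k) : ((G.neighborFinset u).filter (h u < h ·)).card ≤ d - 1 := by
  obtain ⟨v, huv, hv⟩ := hh.exists_adj u hu
  have hlt : ((G.neighborFinset u).filter (h u < h ·)).card < (G.neighborFinset u).card := by
    refine Finset.card_lt_card (Finset.filter_ssubset.2 ⟨v, by simpa using huv, ?_⟩)
    omega
  rw [card_neighborFinset_eq_degree, hreg u] at hlt
  omega

theorem IsHeight.card_level_succ_le [DecidableEq V] (hh : G.IsHeight h k)
    (hreg : G.IsRegularOfDegree d) {i : ℕ} (hi : i < k) :
    (Finset.univ.filter (h · = i + 1)).card ≤ (Finset.univ.filter (h · = i)).card * (d - 1) := by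
  refine (Finset.card_le_card (t := (Finset.univ.filter (h · = i)).biUnion
    fun u => (G.neighborFinset u).filter (h u < h ·)) fun v hv => ?_).trans
    (Finset.card_biUnion_le_card_mul _ _ _ fun u hu => ?_)
  · have hv' : h v = i + 1 := by simpa using hv
    obtain ⟨u, hvu, hu⟩ := hh.exists_adj v (by omega)
    simp only [Finset.mem_biUnion, Finset.mem_filter, Finset.mem_univ, true_and,
      mem_neighborFinset]
    exact ⟨u, by omega, hvu.symm, by omega⟩
  · have hu' : h u = i := by simpa using hu
    exact hh.card_upper_neighbors_le hreg (by omega)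

/-- The last level carries at most the average share of the mass of the test function. -/
theorem IsHeight.mul_sum_last_level_le (hh : G.IsHeight h k) (hreg : G.IsRegularOfDegree d)
    (hd : 2 ≤ d) :
    ((k : ℝ) + 1) * ∑ u, (if h u = k then levelDecay h k (√((d : ℝ) - 1))⁻¹ u ^ 2 else 0) ≤
      ∑ u, levelDecay h k (√((d : ℝ) - 1))⁻¹ u ^ 2 := by
  classical
  have hd' : (0 : ℝ) < (d : ℝ) - 1 := by
    have : (2 : ℝ) ≤ d := by exact_mod_cast hd
    linarith
  set r := (√((d : ℝ) - 1))⁻¹ with hr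
  have hr2 : r ^ 2 = ((d : ℝ) - 1)⁻¹ := by rw [hr, inv_pow, Real.sq_sqrt hd'.le]
  let a : ℕ → ℝ := fun i => ∑ u, if h u = i then (r ^ 2) ^ i else 0
  have ha : ∀ i, a i = (Finset.univ.filter (h · = i)).card * (r ^ 2) ^ i := fun i => by
    simp only [a]
    rw [← Finset.sum_filter, Finset.sum_const, nsmul_eq_mul]
  have hstep : ∀ i < k, a (i + 1) ≤ a i := fun i hi => by
    have hc : ((Finset.univ.filter (h · = i + 1)).card : ℝ) ≤
        (Finset.univ.filter (h · = i)).card * ((d : ℝ) - 1) := by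
      have := hh.card_level_succ_le hreg hi
      have hcast : ((d - 1 : ℕ) : ℝ) = (d : ℝ) - 1 := by
        rw [Nat.cast_sub (by omega), Nat.cast_one]
      rw [← hcast]
      exact_mod_cast this
    rw [ha, ha, hr2]
    calc _ ≤ (Finset.univ.filter (h · = i)).card * ((d : ℝ) - 1) * ((d : ℝ) - 1)⁻¹ ^ (i + 1) :=
          mul_le_mul_of_nonneg_right hc (by positivity)
      _ = _ := by
          rw [pow_succ]
          field_simp
  have hlast : ∀ j, j ≤ k → a k ≤ a (k - j) := by
    intro j
    induction j with
    | zero => intro _; rfl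
    | succ j ih =>
      intro hj
      have := hstep (k - (j + 1)) (by omega)
      rw [show k - (j + 1) + 1 = k - j by omega] at this
      exact (ih (by omega)).trans this
  have hS : ∑ u, levelDecay h k r u ^ 2 = ∑ i ∈ Finset.range (k + 1), a i := by
    simp only [a]
    rw [Finset.sum_comm]
    refine Finset.sum_congr rfl fun u _ => ?_
    rw [Finset.sum_ite_eq]
    simp only [levelDecay, Finset.mem_range, Nat.lt_succ_iff]
    split_ifs
    · rw [← pow_mul, ← pow_mul, mul_comm]
    · simp
  have hk : ∑ u, (if h u = k then levelDecay h k r u ^ 2 else 0) = a k := by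
    refine Finset.sum_congr rfl fun u _ => ?_
    split_ifs with hu
    · rw [levelDecay, if_pos hu.le, hu, ← pow_mul, ← pow_mul, mul_comm]
    · rfl
  rw [hS, hk]
  have := Finset.card_nsmul_le_sum (Finset.range (k + 1)) a (a k) fun i hi => by
    have hi' : i ≤ k := Nat.lt_succ_iff.1 (Finset.mem_range.1 hi)
    simpa [Nat.sub_sub_self hi'] using hlast (k - i) (Nat.sub_le _ _)
  simpa [nsmul_eq_mul] using this

theorem sum_sum_neighborFinset_comm (F : V → V → ℝ) :
    ∑ u, ∑ v ∈ G.neighborFinset u, F u v = ∑ u, ∑ v ∈ G.neighborFinset u, F v u := by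
  simp only [neighborFinset_eq_filter, Finset.sum_filter]
  rw [Finset.sum_comm]
  simp only [G.adj_comm]

theorem IsRegularOfDegree.sum_sum_sub_sq (hreg : G.IsRegularOfDegree d) (f : V → ℝ) :
    ∑ u, ∑ v ∈ G.neighborFinset u, (f u - f v) ^ 2 =
      2 * (d * ∑ u, f u ^ 2 - ∑ u, ∑ v ∈ G.neighborFinset u, f v * f u) := by
  have h₁ : ∑ u, ∑ v ∈ G.neighborFinset u, f u ^ 2 = d * ∑ u, f u ^ 2 := by
    rw [Finset.mul_sum]
    refine Finset.sum_congr rfl fun u _ => ?_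
    rw [Finset.sum_const, card_neighborFinset_eq_degree, hreg u, nsmul_eq_mul]
  have h₂ := sum_sum_neighborFinset_comm (G := G) fun u _ => f u ^ 2
  have h₃ : ∑ u, ∑ v ∈ G.neighborFinset u, (f u - f v) ^ 2 =
      ∑ u, ∑ v ∈ G.neighborFinset u, f u ^ 2 + ∑ u, ∑ v ∈ G.neighborFinset u, f v ^ 2 -
        2 * ∑ u, ∑ v ∈ G.neighborFinset u, f v * f u := by
    simp only [Finset.mul_sum, ← Finset.sum_add_distrib, ← Finset.sum_sub_distrib]
    refine Finset.sum_congr rfl fun u _ => Finset.sum_congr rfl fun v _ => ?_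
    ring
  rw [h₃, ← h₂, h₁]
  ring

theorem IsHeight.sum_upper_neighbors_le (hh : G.IsHeight h k) (hreg : G.IsRegularOfDegree d)
    (hd : 2 ≤ d) (u : V) :
    ∑ v ∈ G.neighborFinset u, (if h u < h v then
      (levelDecay h k (√((d : ℝ) - 1))⁻¹ u - levelDecay h k (√((d : ℝ) - 1))⁻¹ v) ^ 2 else 0) ≤
      (√((d : ℝ) - 1) - 1) ^ 2 * levelDecay h k (√((d : ℝ) - 1))⁻¹ u ^ 2 +
        (2 * √((d : ℝ) - 1) - 1) *
          (if h u = k then levelDecay h k (√((d : ℝ) - 1))⁻¹ u ^ 2 else 0) := by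
  have hd' : (0 : ℝ) < (d : ℝ) - 1 := by
    have : (2 : ℝ) ≤ d := by exact_mod_cast hd
    linarith
  have hq2 := Real.sq_sqrt hd'.le
  have hq := Real.sqrt_pos.2 hd'
  set q := √((d : ℝ) - 1)
  have hcast : ((d - 1 : ℕ) : ℝ) = q ^ 2 := by
    rw [hq2, Nat.cast_sub (by omega), Nat.cast_one]
  rw [← Finset.sum_filter]
  have key : ∀ B : ℝ, 0 ≤ B → h u ≤ k →
      (∀ v, G.Adj u v → h u < h v → (levelDecay h k q⁻¹ u - levelDecay h k q⁻¹ v) ^ 2 ≤ B) →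
      ∑ v ∈ (G.neighborFinset u).filter (h u < h ·),
        (levelDecay h k q⁻¹ u - levelDecay h k q⁻¹ v) ^ 2 ≤ q ^ 2 * B := by
    intro B hB hu hv
    refine (Finset.sum_le_card_nsmul _ _ B fun v hv' => ?_).trans ?_
    · rw [Finset.mem_filter, mem_neighborFinset] at hv'
      exact hv v hv'.1 hv'.2
    · rw [nsmul_eq_mul, ← hcast]
      gcongr
      exact hh.card_upper_neighbors_le hreg hu
  rcases lt_trichotomy (h u) k with hu | hu | hu
  · rw [if_neg hu.ne]
    refine (key ((levelDecay h k q⁻¹ u * (1 - q⁻¹)) ^ 2) (sq_nonneg _) hu.le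
      fun v huv hv => le_of_eq ?_).trans (le_of_eq ?_)
    · have hv' : h v = h u + 1 := by
        have := hh.le_add_one huv
        omega
      rw [levelDecay, levelDecay, if_pos hu.le, if_pos (by omega), hv']
      ring
    · field_simp
      ring
  · rw [if_pos hu]
    refine (key (levelDecay h k q⁻¹ u ^ 2) (sq_nonneg _) hu.le
      fun v huv hv => le_of_eq ?_).trans (le_of_eq (by ring))
    have hv0 : levelDecay h k q⁻¹ v = 0 := if_neg (by omega)
    rw [hv0, sub_zero]
  · have hu0 : levelDecay h k q⁻¹ u = 0 := if_neg (by omega)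
    rw [Finset.sum_eq_zero, hu0]
    · simp
    · intro v hv
      rw [Finset.mem_filter] at hv
      have hv0 : levelDecay h k q⁻¹ v = 0 := if_neg (by omega)
      rw [hu0, hv0]
      simp

/-- The Rayleigh quotient of the test function at a height function. -/
theorem IsHeight.le_rayleigh (hh : G.IsHeight h k) (hreg : G.IsRegularOfDegree d) (hd : 2 ≤ d) :
    (2 * √((d : ℝ) - 1) - 2 * √((d : ℝ) - 1) / ((k : ℝ) + 1)) *
        ∑ u, levelDecay h k (√((d : ℝ) - 1))⁻¹ u ^ 2 ≤
      ∑ u, ∑ v ∈ G.neighborFinset u,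
        levelDecay h k (√((d : ℝ) - 1))⁻¹ v * levelDecay h k (√((d : ℝ) - 1))⁻¹ u := by
  have hd' : (1 : ℝ) ≤ (d : ℝ) - 1 := by
    have : (2 : ℝ) ≤ d := by exact_mod_cast hd
    linarith
  have hmass := hh.mul_sum_last_level_le hreg hd
  have hup := Finset.sum_le_sum fun u (_ : u ∈ Finset.univ) => hh.sum_upper_neighbors_le hreg hd u
  have hq2 := Real.sq_sqrt (zero_le_one.trans hd')
  have hq : 1 ≤ √((d : ℝ) - 1) := Real.one_le_sqrt.2 hd'
  set q := √((d : ℝ) - 1)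
  set f := levelDecay h k q⁻¹ with hf
  have hlap := hreg.sum_sum_sub_sq f
  set P : V → V → ℝ := fun u v => if h u < h v then (f u - f v) ^ 2 else 0 with hP
  have hsym : ∑ u, ∑ v ∈ G.neighborFinset u, (f u - f v) ^ 2 ≤
      2 * ∑ u, ∑ v ∈ G.neighborFinset u, P u v := by
    rw [two_mul]
    nth_rw 2 [sum_sum_neighborFinset_comm]
    simp only [← Finset.sum_add_distrib]
    refine Finset.sum_le_sum fun u _ => Finset.sum_le_sum fun v _ => ?_
    rcases lt_trichotomy (h u) (h v) with huv | huv | huv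
    · simp [hP, huv, huv.not_gt]
    · simp [hP, hf, levelDecay, huv]
    · simp only [hP, huv, huv.not_gt, if_true, if_false]
      exact le_of_eq (by ring)
  rw [Finset.sum_add_distrib, ← Finset.mul_sum, ← Finset.mul_sum] at hup
  set S := ∑ u, f u ^ 2
  set L := ∑ u, if h u = k then f u ^ 2 else 0
  have hk : (0 : ℝ) < (k : ℝ) + 1 := by positivity
  have hL : L ≤ S / (k + 1) := by
    rw [le_div_iff₀ hk, mul_comm]
    exact hmass
  have hS : 0 ≤ S / (k + 1) :=
    div_nonneg (Finset.sum_nonneg fun u _ => sq_nonneg _) hk.le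
  have hL' : (2 * q - 1) * L ≤ (2 * q - 1) * (S / (k + 1)) :=
    mul_le_mul_of_nonneg_left hL (by linarith)
  have hexp : (2 * q - 2 * q / ((k : ℝ) + 1)) * S = 2 * q * S - 2 * q * (S / (k + 1)) := by ring
  have hdq : (d : ℝ) = q ^ 2 + 1 := by linarith
  rw [hdq] at hlap
  rw [hexp]
  nlinarith

end Finite

/-- The distance to the edge `s(a, b)`, set to `k + 1` outside its component. -/
noncomputable def edgeHeight (a b : V) (k : ℕ) (u : V) : ℕ :=
  open Classical in if G.Reachable a u then min (G.dist a u) (G.dist b u) else k + 1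

variable {G}

theorem Reachable.exists_adj_dist_eq {a u : V} {n : ℕ} (hau : G.Reachable a u)
    (hn : G.dist a u = n + 1) : ∃ v, G.Adj u v ∧ G.dist a v = n := by
  obtain ⟨p, hp⟩ := hau.symm.exists_walk_length_eq_dist
  rw [dist_comm, hn] at hp
  cases p with
  | nil => simp at hp
  | @cons _ v _ huv p =>
    refine ⟨v, huv, le_antisymm ?_ ?_⟩
    · rw [dist_comm]
      refine (dist_le p).trans ?_
      simpa using hp.le
    · have := huv.symm.diff_dist_adj (u := a)
      omega

theorem edgeHeight_comm {a b : V} (hab : G.Adj a b) (k : ℕ) :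
    G.edgeHeight a b k = G.edgeHeight b a k := by
  funext u
  have : G.Reachable a u ↔ G.Reachable b u :=
    ⟨hab.symm.reachable.trans, hab.reachable.trans⟩
  by_cases h : G.Reachable a u
  · rw [edgeHeight, edgeHeight, if_pos h, if_pos (this.1 h), min_comm]
  · rw [edgeHeight, edgeHeight, if_neg h, if_neg fun h' => h (this.2 h')]

theorem isHeight_edgeHeight {a b : V} (hab : G.Adj a b) (k : ℕ) :
    G.IsHeight (G.edgeHeight a b k) k where
  le_add_one u v huv := by
    have hr : G.Reachable a u ↔ G.Reachable a v :=
      ⟨fun h => h.trans huv.reachable, fun h => h.trans huv.symm.reachable⟩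
    have h₁ := huv.diff_dist_adj (u := a)
    have h₂ := huv.diff_dist_adj (u := b)
    by_cases h : G.Reachable a u
    · rw [edgeHeight, edgeHeight, if_pos h, if_pos (hr.1 h)]
      omega
    · rw [edgeHeight, edgeHeight, if_neg h, if_neg fun h' => h (hr.2 h')]
      omega
  exists_adj u hu := by
    have hau : G.Reachable a u := by
      by_contra h
      simp [edgeHeight, h] at hu
    clear hu
    wlog hle : G.dist a u ≤ G.dist b u generalizing a b
    · have := this hab.symm (hab.symm.reachable.trans hau) (by omega)
      rwa [edgeHeight_comm hab]
    have hbu : G.Reachable b u := hab.symm.reachable.trans hau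
    have hu : G.edgeHeight a b k u = G.dist a u := by simp [edgeHeight, hau, hle]
    rcases hn : G.dist a u with _ | n
    · obtain rfl := hau.dist_eq_zero_iff.1 hn
      exact ⟨b, hab, by simp [edgeHeight, hab.reachable]⟩
    · obtain ⟨v, huv, hv⟩ := hau.exists_adj_dist_eq hn
      have h₂ := huv.diff_dist_adj (u := b)
      refine ⟨v, huv, ?_⟩
      rw [hu, hn, edgeHeight, if_pos (hau.trans huv.reachable)]
      omega

theorem exists_walk_of_edgeHeight_le {a b u : V} {k : ℕ} (hab : G.Adj a b)
    (hu : G.edgeHeight a b k u ≤ k) :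
    ∃ c ∈ s(a, b), ∃ p : G.Walk c u, p.length ≤ k := by
  have hau : G.Reachable a u := by
    by_contra h
    simp [edgeHeight, h] at hu
  rw [edgeHeight, if_pos hau, min_le_iff] at hu
  rcases hu with hu | hu
  · obtain ⟨p, hp⟩ := hau.exists_walk_length_eq_dist
    exact ⟨a, by simp, p, hp.trans_le hu⟩
  · obtain ⟨p, hp⟩ := (hab.symm.reachable.trans hau).exists_walk_length_eq_dist
    exact ⟨b, by simp, p, hp.trans_le hu⟩

end SimpleGraph

/-- **Nilli's theorem.** Let `G` be a finite `d`-regular graph (`d ≥ 2`) containing two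
edges `e₁, e₂` whose graph distance (minimum over endpoints) is at least `2k + 2`, for
some `k ≥ 1`.  List the eigenvalues of the adjacency matrix of `G` in decreasing order
`lam 0 ≥ lam 1 ≥ …` (so that the characteristic polynomial is `∏ i, (X - lam i)`).
Then the second largest eigenvalue `lam 1` satisfies
`lam 1 ≥ 2√(d-1) - 2√(d-1)/(k+1)`. -/
theorem nilli_second_eigenvalue (V : Type) [Fintype V] [DecidableEq V]
    (G : SimpleGraph V) [DecidableRel G.Adj] (d k : ℕ) (hd : 2 ≤ d) (hk : 1 ≤ k)
    (hreg : G.IsRegularOfDegree d)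
    (e₁ e₂ : Sym2 V) (he₁ : e₁ ∈ G.edgeSet) (he₂ : e₂ ∈ G.edgeSet)
    (hdist : ∀ u v : V, u ∈ e₁ → v ∈ e₂ → 2 * k + 2 ≤ G.dist u v)
    (lam : Fin (Fintype.card V) → ℝ) (hanti : Antitone lam)
    (hchar : (G.adjMatrix ℝ).charpoly = ∏ i, (X - C (lam i))) :
    ∀ i : Fin (Fintype.card V), (i : ℕ) = 1 →
      2 * Real.sqrt ((d : ℝ) - 1) - 2 * Real.sqrt ((d : ℝ) - 1) / ((k : ℝ) + 1) ≤ lam i := by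
  intro i hi
  induction e₁ using Sym2.ind with | _ a₁ b₁
  induction e₂ using Sym2.ind with | _ a₂ b₂
  rw [SimpleGraph.mem_edgeSet] at he₁ he₂
  have hA : (G.adjMatrix ℝ).IsHermitian := by
    rw [Matrix.IsHermitian, Matrix.conjTranspose_eq_transpose_of_trivial,
      SimpleGraph.transpose_adjMatrix]
  rw [hA.eq_eigenvalues₀_of_charpoly_eq hanti hchar]
  let f (a b : V) : V → ℝ :=
    SimpleGraph.levelDecay (G.edgeHeight a b k) k (√((d : ℝ) - 1))⁻¹
  have hne (a b : V) : WithLp.toLp 2 (f a b) ≠ 0 := fun h => by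
    have := congrArg (fun x : EuclideanSpace ℝ V => x a) h
    simp [f, SimpleGraph.levelDecay, SimpleGraph.edgeHeight] at this
  have hinner (x y : V → ℝ) :
      inner ℝ (WithLp.toLp 2 x : EuclideanSpace ℝ V) (WithLp.toLp 2 y) = ∑ u, x u * y u := by
    simp [PiLp.inner_apply, mul_comm]
  have hinner' (x y : V → ℝ) :
      inner ℝ ((G.adjMatrix ℝ).toEuclideanLin (WithLp.toLp 2 x)) (WithLp.toLp 2 y) =
        ∑ u, ∑ v ∈ G.neighborFinset u, x v * y u := by
    rw [Matrix.toLpLin_apply, hinner]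
    simp only [SimpleGraph.adjMatrix_mulVec_apply, Finset.sum_mul]
  have hray (a b : V) (hab : G.Adj a b) := by
    have := (SimpleGraph.isHeight_edgeHeight hab k).le_rayleigh hreg hd
    simp only [pow_two] at this
    rwa [← hinner, ← hinner'] at this
  have hfar (u v : V) (p : G.Walk u v) (hp : p.length ≤ 1) : f a₁ b₁ u * f a₂ b₂ v = 0 := by
    by_contra h
    obtain ⟨hu, hv⟩ := mul_ne_zero_iff.1 h
    simp only [f, SimpleGraph.levelDecay, ne_eq, ite_eq_right_iff, Classical.not_imp] at hu hv
    obtain ⟨c₁, hc₁, p₁, hp₁⟩ := SimpleGraph.exists_walk_of_edgeHeight_le he₁ hu.1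
    obtain ⟨c₂, hc₂, p₂, hp₂⟩ := SimpleGraph.exists_walk_of_edgeHeight_le he₂ hv.1
    have h₁ := hdist c₁ c₂ hc₁ hc₂
    have h₂ := SimpleGraph.dist_le ((p₁.append p).append p₂.reverse)
    simp only [SimpleGraph.Walk.length_append, SimpleGraph.Walk.length_reverse] at h₂
    omega
  refine LinearMap.IsSymmetric.le_eigenvalues_one _ _ (hne a₁ b₁) (hne a₂ b₂) ?_ ?_
    (hray a₁ b₁ he₁) (hray a₂ b₂ he₂) i hi
  · rw [hinner]
    exact Finset.sum_eq_zero fun u _ => hfar u u .nil (by simp)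
  · rw [hinner']
    refine Finset.sum_eq_zero fun u _ => Finset.sum_eq_zero fun v hv => ?_
    rw [SimpleGraph.mem_neighborFinset] at hv
    exact hfar v u hv.symm.toWalk (by simp)
end
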